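/- Let p > 3 be a prime. Then H²(SL₂(ℤ[1/p]), ℤ) ≅ ℤ^{N(p)} ⊕ ℤ/12, where N(p) = (p-7)/6 if p ≡ 1 (mod 12), (p+1)/6 if p ≡ 5 (mod 12), (p-1)/6 if p ≡ 7 (mod 12), and (p+7)/6 if p ≡ 11 (mod 12). -/

import Mathlib

namespace H2SL2

/-! ### Amalgams via ping-pong -/

/-- Alternating words in `A \ B` and `B \ A`; the index records the side of the first letter. -/
inductive Alt {L : Type*} [Group L] (A B : Subgroup L) : Bool → L → Prop
  | sA (x : L) : x ∈ A → x ∉ B → Alt A B true x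
  | sB (x : L) : x ∈ B → x ∉ A → Alt A B false x
  | cA (x y : L) : x ∈ A → x ∉ B → Alt A B false y → Alt A B true (x * y)
  | cB (x y : L) : x ∈ B → x ∉ A → Alt A B true y → Alt A B false (x * y)

theorem Alt.mulC {L : Type*} [Group L] {A B : Subgroup L} {c : L} (hA : c ∈ A) (hB : c ∈ B)
    {i : Bool} {x : L} (h : Alt A B i x) : Alt A B i (c * x) := by
  cases h with
  | sA x h1 h2 => exact .sA _ (A.mul_mem hA h1) (fun h => h2 ((B.mul_mem_cancel_left hB).1 h))
  | sB x h1 h2 => exact .sB _ (B.mul_mem hB h1) (fun h => h2 ((A.mul_mem_cancel_left hA).1 h))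
  | cA x y h1 h2 h3 =>
    rw [← mul_assoc]
    exact .cA _ _ (A.mul_mem hA h1) (fun h => h2 ((B.mul_mem_cancel_left hB).1 h)) h3
  | cB x y h1 h2 h3 =>
    rw [← mul_assoc]
    exact .cB _ _ (B.mul_mem hB h1) (fun h => h2 ((A.mul_mem_cancel_left hA).1 h)) h3

/-- Elements which are in the intersection or are alternating words. -/
def AGood {L : Type*} [Group L] (A B : Subgroup L) (x : L) : Prop :=
  (x ∈ A ∧ x ∈ B) ∨ ∃ i, Alt A B i x

theorem AGood.mulA {L : Type*} [Group L] {A B : Subgroup L} {a : L} (ha : a ∈ A)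
    {x : L} (h : AGood A B x) : AGood A B (a * x) := by
  by_cases hb : a ∈ B
  · rcases h with ⟨h1, h2⟩ | ⟨i, h⟩
    · exact .inl ⟨A.mul_mem ha h1, B.mul_mem hb h2⟩
    · exact .inr ⟨i, h.mulC ha hb⟩
  rcases h with ⟨h1, h2⟩ | ⟨i, h⟩
  · exact .inr ⟨true, .sA _ (A.mul_mem ha h1) (fun h => hb ((B.mul_mem_cancel_right h2).1 h))⟩
  · cases h with
    | sA x h1 h2 =>
      by_cases h3 : a * x ∈ B
      · exact .inl ⟨A.mul_mem ha h1, h3⟩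
      · exact .inr ⟨true, .sA _ (A.mul_mem ha h1) h3⟩
    | sB x h1 h2 => exact .inr ⟨true, .cA _ _ ha hb (.sB _ h1 h2)⟩
    | cA x y h1 h2 h4 =>
      rw [← mul_assoc]
      by_cases h3 : a * x ∈ B
      · exact .inr ⟨false, h4.mulC (A.mul_mem ha h1) h3⟩
      · exact .inr ⟨true, .cA _ _ (A.mul_mem ha h1) h3 h4⟩
    | cB x y h1 h2 h4 => exact .inr ⟨true, .cA _ _ ha hb (.cB _ _ h1 h2 h4)⟩

theorem AGood.mulB {L : Type*} [Group L] {A B : Subgroup L} {a : L} (ha : a ∈ B)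
    {x : L} (h : AGood A B x) : AGood A B (a * x) := by
  by_cases hb : a ∈ A
  · exact h.mulA hb
  rcases h with ⟨h2, h1⟩ | ⟨i, h⟩
  · exact .inr ⟨false, .sB _ (B.mul_mem ha h1) (fun h => hb ((A.mul_mem_cancel_right h2).1 h))⟩
  · cases h with
    | sB x h1 h2 =>
      by_cases h3 : a * x ∈ A
      · exact .inl ⟨h3, B.mul_mem ha h1⟩
      · exact .inr ⟨false, .sB _ (B.mul_mem ha h1) h3⟩
    | sA x h1 h2 => exact .inr ⟨false, .cB _ _ ha hb (.sA _ h1 h2)⟩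
    | cB x y h1 h2 h4 =>
      rw [← mul_assoc]
      by_cases h3 : a * x ∈ A
      · exact .inr ⟨true, h4.mulC h3 (B.mul_mem ha h1)⟩
      · exact .inr ⟨false, .cB _ _ (B.mul_mem ha h1) h3 h4⟩
    | cA x y h1 h2 h4 => exact .inr ⟨false, .cB _ _ ha hb (.cA _ _ h1 h2 h4)⟩

theorem AGood.of_mem_sup {L : Type*} [Group L] {A B : Subgroup L} {x : L} (hx : x ∈ A ⊔ B) :
    AGood A B x := by
  rw [Subgroup.sup_eq_closure] at hx
  induction hx using Subgroup.closure_induction_left with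
  | one => exact .inl ⟨A.one_mem, B.one_mem⟩
  | mul_left x hx y hy ih =>
    rcases hx with hx | hx
    · exact ih.mulA hx
    · exact ih.mulB hx
  | inv_mul_cancel x hx y hy ih =>
    rcases hx with hx | hx
    · exact ih.mulA (A.inv_mem hx)
    · exact ih.mulB (B.inv_mem hx)

/-- Ping-pong data for two subgroups. -/
structure PingPong {K : Type*} [Group K] (A B : Subgroup K) where
  Y : Type
  act : K → Y → Y
  act_mul : ∀ g h y, act (g * h) y = act g (act h y)
  act_one : ∀ y, act 1 y = y
  N : Y → ℚ
  P : Y → Prop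
  Q : Y → Prop
  exP : ∃ y, P y
  exQ : ∃ y, Q y
  stepA : ∀ a ∈ A, a ∉ B → ∀ y, Q y → P (act a y) ∧ N y ≤ N (act a y)
  stepB : ∀ b ∈ B, b ∉ A → ∀ y, P y → Q (act b y) ∧ N y < N (act b y)

theorem PingPong.alt {L K : Type*} [Group L] [Group K] {A B : Subgroup K} (D : PingPong A B)
    (π : L →* K) {A' B' : Subgroup L} (hA : ∀ x ∈ A', x ∉ B' → π x ∈ A ∧ π x ∉ B)
    (hB : ∀ x ∈ B', x ∉ A' → π x ∈ B ∧ π x ∉ A) {i : Bool} {x : L} (h : Alt A' B' i x) :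
    ∃ y, (if i then D.P (D.act (π x) y) else D.Q (D.act (π x) y)) ∧
      D.N y ≤ D.N (D.act (π x) y) ∧
      (D.N y < D.N (D.act (π x) y) ∨ (i = true ∧ π x ∉ B)) := by
  induction h with
  | sA x h1 h2 =>
    obtain ⟨y, hy⟩ := D.exQ
    obtain ⟨h3, h4⟩ := hA x h1 h2
    have := D.stepA _ h3 h4 y hy
    exact ⟨y, by simpa using this.1, this.2, .inr ⟨rfl, h4⟩⟩
  | sB x h1 h2 =>
    obtain ⟨y, hy⟩ := D.exP
    obtain ⟨h3, h4⟩ := hB x h1 h2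
    have := D.stepB _ h3 h4 y hy
    exact ⟨y, by simpa using this.1, this.2.le, .inl this.2⟩
  | cA x z h1 h2 h5 ih =>
    obtain ⟨y, hy, hy2, hy3⟩ := ih
    obtain ⟨h3, h4⟩ := hA x h1 h2
    have := D.stepA _ h3 h4 _ (by simpa using hy)
    refine ⟨y, ?_, ?_, .inl ?_⟩
    · simpa [D.act_mul] using this.1
    · simpa [D.act_mul] using hy2.trans this.2
    · simp at hy3
      simpa [D.act_mul] using hy3.trans_le this.2
  | cB x z h1 h2 h5 ih =>
    obtain ⟨y, hy, hy2, hy3⟩ := ih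
    obtain ⟨h3, h4⟩ := hB x h1 h2
    have := D.stepB _ h3 h4 _ (by simpa using hy)
    refine ⟨y, ?_, ?_, .inl ?_⟩
    · simpa [D.act_mul] using this.1
    · simpa [D.act_mul] using hy2.trans this.2.le
    · simpa [D.act_mul] using hy2.trans_lt this.2

theorem PingPong.alt_ne_one {L K : Type*} [Group L] [Group K] {A B : Subgroup K}
    (D : PingPong A B)
    (π : L →* K) {A' B' : Subgroup L} (hA : ∀ x ∈ A', x ∉ B' → π x ∈ A ∧ π x ∉ B)
    (hB : ∀ x ∈ B', x ∉ A' → π x ∈ B ∧ π x ∉ A) {i : Bool} {x : L} (h : Alt A' B' i x) :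
    π x ≠ 1 := by
  intro h1
  obtain ⟨y, -, -, h | h⟩ := D.alt π hA hB h
  · simp [h1, D.act_one] at h
  · exact h.2 (h1 ▸ B.one_mem)

/-- The universal property of the amalgamated product of `A` and `B` over `A ⊓ B`. -/
def IsAmalgam {K : Type} [Group K] (A B : Subgroup K) : Prop :=
  ∀ (E : Type) [Group E] (α : A →* E) (β : B →* E),
    (∀ x (ha : x ∈ A) (hb : x ∈ B), α ⟨x, ha⟩ = β ⟨x, hb⟩) →
    ∃ ψ : K →* E, (∀ a : A, ψ a = α a) ∧ ∀ b : B, ψ b = β b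

theorem PingPong.isAmalgam {K : Type} [Group K] {A B : Subgroup K} (D : PingPong A B)
    (hgen : A ⊔ B = ⊤) : IsAmalgam A B := by
  intro E _ α β hag
  let A' : Subgroup (K × E) := (A.subtype.prod α).range
  let B' : Subgroup (K × E) := (B.subtype.prod β).range
  let Γ := A' ⊔ B'
  have memA (a : A) : ((a : K), α a) ∈ A' := ⟨a, rfl⟩
  have memB (b : B) : ((b : K), β b) ∈ B' := ⟨b, rfl⟩
  have hA : ∀ x ∈ A', x ∉ B' → MonoidHom.fst K E x ∈ A ∧ MonoidHom.fst K E x ∉ B := by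
    rintro _ ⟨a, rfl⟩ h
    refine ⟨a.2, fun hb => h ?_⟩
    refine ⟨⟨_, hb⟩, ?_⟩
    have := hag a a.2 hb
    simpa using this.symm
  have hB : ∀ x ∈ B', x ∉ A' → MonoidHom.fst K E x ∈ B ∧ MonoidHom.fst K E x ∉ A := by
    rintro _ ⟨b, rfl⟩ h
    refine ⟨b.2, fun ha => h ?_⟩
    refine ⟨⟨_, ha⟩, ?_⟩
    have := hag b ha b.2
    simpa using this
  let π : Γ →* K := (MonoidHom.fst K E).comp Γ.subtype
  have hinj : Function.Injective π := by
    rw [injective_iff_map_eq_one]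
    rintro ⟨x, hx⟩ h1
    rcases AGood.of_mem_sup hx with ⟨⟨a, rfl⟩, -⟩ | ⟨i, h⟩
    · have : a = 1 := Subtype.ext h1
      subst this
      ext <;> simp
    · exact absurd h1 (D.alt_ne_one (MonoidHom.fst K E) hA hB h)
  have hsurj : Function.Surjective π := by
    rw [← MonoidHom.range_eq_top, eq_top_iff, ← hgen, sup_le_iff]
    exact ⟨fun a ha => ⟨⟨_, Subgroup.mem_sup_left (memA ⟨a, ha⟩)⟩, rfl⟩,
      fun a ha => ⟨⟨_, Subgroup.mem_sup_right (memB ⟨a, ha⟩)⟩, rfl⟩⟩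
  let e := MulEquiv.ofBijective π ⟨hinj, hsurj⟩
  refine ⟨(MonoidHom.snd K E).comp (Γ.subtype.comp e.symm.toMonoidHom), fun a => ?_, fun b => ?_⟩
  · have : e.symm (a : K) = ⟨_, Subgroup.mem_sup_left (memA a)⟩ := by
      rw [MulEquiv.symm_apply_eq]; rfl
    simp [this]
  · have : e.symm (b : K) = ⟨_, Subgroup.mem_sup_right (memB b)⟩ := by
      rw [MulEquiv.symm_apply_eq]; rfl
    simp [this]

end H2SL2

namespace H2SL2

/-! ### The presentation of `SL(2, ℤ)` -/

/-- The group `SL(2, ℤ)`. -/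
abbrev SL2Z := Matrix.SpecialLinearGroup (Fin 2) ℤ

open ModularGroup in
/-- The standard element of order six. -/
def Umat : SL2Z := S * T

open ModularGroup

theorem S_four : S ^ 4 = 1 := by decide
theorem S_sq : S ^ 2 = Umat ^ 3 := by decide
theorem U_six : Umat ^ 6 = 1 := by decide

theorem zpow_red {K : Type*} [Group K] {g : K} {k : ℕ} (hk : 0 < k) (hg : g ^ k = 1) (n : ℤ) :
    g ^ n = g ^ (n % k).toNat := by
  have h : ((n % k).toNat : ℤ) = n % k := Int.toNat_of_nonneg (Int.emod_nonneg _ (by omega))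
  rw [← zpow_natCast, h]
  conv_lhs => rw [← Int.emod_add_mul_ediv n k, zpow_add, zpow_mul, zpow_natCast, hg, one_zpow,
    mul_one]

theorem exists_pow_red {K : Type*} [Group K] {g : K} {k : ℕ} (hk : 0 < k) (hg : g ^ k = 1)
    (n : ℤ) : ∃ m : ℕ, m < k ∧ g ^ n = g ^ m :=
  ⟨_, by have := Int.emod_lt_of_pos n (b := k) (by omega)
         have := Int.emod_nonneg n (b := k) (by omega)
         omega, zpow_red hk hg n⟩

theorem exists_hom_zpowers {K E : Type*} [Group K] [Group E] (g : K) (s : E)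
    (h : orderOf s ∣ orderOf g) :
    ∃ α : Subgroup.zpowers g →* E, ∀ (n : ℕ) (hx), α ⟨g ^ n, hx⟩ = s ^ n := by
  let g' : Subgroup.zpowers g := ⟨g, Subgroup.mem_zpowers g⟩
  have hg : ∀ x, x ∈ Subgroup.zpowers g' := by
    rintro ⟨_, n, rfl⟩
    exact ⟨n, by ext; simp [g']⟩
  have h' : orderOf s ∣ orderOf g' := by rwa [Subgroup.orderOf_mk]
  refine ⟨monoidHomOfForallMemZpowers hg h', fun n hx => ?_⟩
  have : (⟨g ^ n, hx⟩ : Subgroup.zpowers g) = g' ^ n := by ext; simp [g']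
  rw [this, map_pow, monoidHomOfForallMemZpowers_apply_gen]

theorem order_S : orderOf S = 4 := by
  rw [orderOf_eq_iff (by norm_num)]
  refine ⟨S_four, fun m hm h0 => ?_⟩
  interval_cases m <;> decide

theorem order_U : orderOf Umat = 6 := by
  rw [orderOf_eq_iff (by norm_num)]
  refine ⟨U_six, fun m hm h0 => ?_⟩
  interval_cases m <;> decide

theorem closure_SU : Subgroup.zpowers S ⊔ Subgroup.zpowers Umat = ⊤ := by
  rw [eq_top_iff, ← SpecialLinearGroup.SL2Z_generators, Subgroup.closure_le]
  have hS : S ∈ Subgroup.zpowers S ⊔ Subgroup.zpowers Umat :=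
    Subgroup.mem_sup_left (Subgroup.mem_zpowers _)
  have hU : Umat ∈ Subgroup.zpowers S ⊔ Subgroup.zpowers Umat :=
    Subgroup.mem_sup_right (Subgroup.mem_zpowers _)
  rintro x (rfl | rfl)
  · exact hS
  · have : T = S⁻¹ * Umat := by simp [Umat]
    rw [this]
    exact mul_mem (inv_mem hS) hU

theorem pow_S_mem {n : ℕ} (hn : n < 4) (h : S ^ n ∉ Subgroup.zpowers Umat) : n = 1 ∨ n = 3 := by
  interval_cases n
  · exact absurd (by simp) h
  · simp
  · exact absurd ⟨3, by simp only [S_sq]; rfl⟩ h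
  · simp

theorem pow_U_mem {n : ℕ} (hn : n < 6) (h : Umat ^ n ∉ Subgroup.zpowers S) :
    n = 1 ∨ n = 2 ∨ n = 4 ∨ n = 5 := by
  interval_cases n
  · exact absurd (by simp) h
  · simp
  · simp
  · exact absurd ⟨2, by simp only [← S_sq]; rfl⟩ h
  · simp
  · simp

theorem S1 : (S ^ 1).1 = !![0, -1; 1, 0] := by decide
theorem S3 : (S ^ 3).1 = !![0, 1; -1, 0] := by decide
theorem U1 : (Umat ^ 1).1 = !![0, -1; 1, 1] := by decide
theorem U2 : (Umat ^ 2).1 = !![-1, -1; 1, 0] := by decide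
theorem U4 : (Umat ^ 4).1 = !![0, 1; -1, -1] := by decide
theorem U5 : (Umat ^ 5).1 = !![1, 1; -1, 0] := by decide

/-- Ping-pong for `SL(2, ℤ)`. -/
def pingSL2Z : PingPong (Subgroup.zpowers S) (Subgroup.zpowers Umat) where
  Y := ℤ × ℤ
  act g v := (g.1 0 0 * v.1 + g.1 0 1 * v.2, g.1 1 0 * v.1 + g.1 1 1 * v.2)
  act_mul g h y := by
    ext <;> simp [Matrix.mul_apply, Fin.sum_univ_two] <;> ring
  act_one y := by simp
  N v := ((|v.1| + |v.2| : ℤ) : ℚ)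
  P v := 0 < v.1 * v.2
  Q v := v.1 * v.2 < 0
  exP := ⟨(1, 1), by norm_num⟩
  exQ := ⟨(1, -1), by norm_num⟩
  stepA := by
    rintro _ ⟨n, rfl⟩ ha ⟨x, y⟩ hv
    obtain ⟨m, hm, h⟩ := exists_pow_red (by norm_num) S_four n
    simp only [h] at ha ⊢
    simp only [Int.cast_le]
    rcases pow_S_mem hm ha with rfl | rfl
    · rw [S1]; simp at hv ⊢; constructor
      · linarith
      · linarith
    · rw [S3]; simp at hv ⊢; constructor
      · linarith
      · linarith
  stepB := by
    rintro _ ⟨n, rfl⟩ ha ⟨x, y⟩ hv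
    obtain ⟨m, hm, h⟩ := exists_pow_red (by norm_num) U_six n
    simp only [h] at ha ⊢
    simp only [Int.cast_lt]
    have hx : x ≠ 0 := by rintro rfl; simp at hv
    have hy : y ≠ 0 := by rintro rfl; simp at hv
    have hx' := abs_pos.2 hx
    have hy' := abs_pos.2 hy
    have hx2 : 0 < x * x := mul_self_pos.2 hx
    have hy2 : 0 < y * y := mul_self_pos.2 hy
    simp only at hv
    have hxy : |x + y| = |x| + |y| := by
      rw [abs_add_eq_add_abs_iff]
      rcases pos_and_pos_or_neg_and_neg_of_mul_pos hv with h | h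
      · left; constructor <;> linarith
      · right; constructor <;> linarith
    have hxy2 : |-x + -y| = |x| + |y| := by rw [← hxy, ← abs_neg]; ring_nf
    rcases pow_U_mem hm ha with rfl | rfl | rfl | rfl
    · rw [U1]; simp at hv ⊢; constructor
      · nlinarith
      · rw [hxy]; linarith
    · rw [U2]; simp at hv ⊢; constructor
      · nlinarith
      · rw [hxy2]; linarith
    · rw [U4]; simp at hv ⊢; constructor
      · nlinarith
      · rw [hxy2]; linarith
    · rw [U5]; simp at hv ⊢; constructor
      · nlinarith
      · rw [hxy]; linarith

theorem SU_eq {m n : ℕ} (hm : m < 4) (hn : n < 6) (h : S ^ m = Umat ^ n) :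
    (m = 0 ∧ n = 0) ∨ (m = 2 ∧ n = 3) := by
  have key : ∀ m < 4, ∀ n < 6, S ^ m = Umat ^ n → (m = 0 ∧ n = 0) ∨ (m = 2 ∧ n = 3) := by decide
  exact key m hm n hn h

theorem SL2Z_presentation (E : Type) [Group E] (s u : E) (hs : s ^ 4 = 1) (hsu : s ^ 2 = u ^ 3) :
    ∃ ψ : SL2Z →* E, ψ S = s ∧ ψ Umat = u := by
  have hu : u ^ 6 = 1 := by
    rw [show 6 = 3 * 2 from rfl, pow_mul, ← hsu, ← pow_mul, hs]
  obtain ⟨α, hα⟩ := exists_hom_zpowers S s (by rw [order_S]; exact orderOf_dvd_of_pow_eq_one hs)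
  obtain ⟨β, hβ⟩ := exists_hom_zpowers Umat u (by rw [order_U]; exact orderOf_dvd_of_pow_eq_one hu)
  obtain ⟨ψ, h1, h2⟩ := pingSL2Z.isAmalgam closure_SU E α β (by
    rintro x ⟨m, rfl⟩ ⟨n, hn⟩
    obtain ⟨m', hm', h3⟩ := exists_pow_red (by norm_num) S_four m
    obtain ⟨n', hn', h4⟩ := exists_pow_red (by norm_num) U_six n
    simp only at hn
    have h5 : S ^ m' = Umat ^ n' := by rw [← h3, ← h4, hn]
    have h6 := SU_eq hm' hn' h5
    calc α ⟨S ^ m, _⟩ = s ^ m' := by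
          rw [← hα m' ⟨m, h3⟩]; congr 1; ext1; exact h3
      _ = u ^ n' := by
          rcases h6 with ⟨rfl, rfl⟩ | ⟨rfl, rfl⟩
          · simp
          · exact hsu
      _ = _ := by
          rw [← hβ n' ⟨n, h4⟩]; congr 1; ext1; exact h5.symm.trans h3.symm)
  refine ⟨ψ, ?_, ?_⟩
  · have := h1 ⟨S ^ (1 : ℕ), ⟨1, by simp⟩⟩
    replace this := this.trans (hα 1 _)
    simpa using this
  · have := h2 ⟨Umat ^ (1 : ℕ), ⟨1, by simp⟩⟩
    replace this := this.trans (hβ 1 _)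
    simpa using this

theorem SL2Z_hom_ext {E : Type*} [Monoid E] {f g : SL2Z →* E} (h1 : f S = g S)
    (h2 : f Umat = g Umat) : f = g := by
  have h : Subgroup.closure {S, Umat} = ⊤ := by
    rw [← closure_SU, Subgroup.zpowers_eq_closure, Subgroup.zpowers_eq_closure,
      ← Subgroup.closure_union]
    rfl
  apply MonoidHom.eq_of_eqOn_dense h
  rintro x (rfl | rfl)
  · exact h1
  · exact h2

end H2SL2

namespace H2SL2

/-! ### Cocycles, central extensions and the amalgam -/

/-- Integral 2-cocycles. -/
def Z2 (G : Type*) [Group G] : Submodule ℤ (G × G → ℤ) where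
  carrier := {f | ∀ g h j, f (g * h, j) + f (g, h) = f (h, j) + f (g, h * j)}
  add_mem' := by
    intro a b ha hb g h j
    have := ha g h j
    have := hb g h j
    simp only [Pi.add_apply]
    linarith
  zero_mem' := by intro g h j; simp
  smul_mem' := by
    intro c a ha g h j
    have := ha g h j
    simp only [Pi.smul_apply, ← smul_add, this]

/-- `f` is the coboundary of `φ`. -/
def IsD {G : Type*} [Group G] (f : G × G → ℤ) (φ : G → ℤ) : Prop :=
  ∀ g h, f (g, h) = φ h - φ (g * h) + φ g

/-- Additive characters. -/
def HomZ (G : Type*) [Group G] : Submodule ℤ (G → ℤ) where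
  carrier := {f | ∀ g h, f (g * h) = f g + f h}
  add_mem' := by
    intro a b ha hb g h
    simp only [Pi.add_apply, ha g h, hb g h]; ring
  zero_mem' := by intro g h; simp
  smul_mem' := by
    intro c a ha g h
    simp only [Pi.smul_apply, ha g h, smul_add]

theorem HomZ.mul {G : Type*} [Group G] (f : HomZ G) (g h : G) : f.1 (g * h) = f.1 g + f.1 h :=
  f.2 g h

theorem HomZ.one {G : Type*} [Group G] (f : HomZ G) : f.1 1 = 0 := by
  have := HomZ.mul f 1 1
  simp at this
  exact this

theorem HomZ.inv {G : Type*} [Group G] (f : HomZ G) (g : G) : f.1 g⁻¹ = - f.1 g := by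
  have := HomZ.mul f g⁻¹ g
  simp [HomZ.one f] at this
  linarith

/-- The central extension defined by a cocycle. -/
@[ext] structure CExt {G : Type*} [Group G] (f : Z2 G) where
  g : G
  n : ℤ

instance {G : Type*} [Group G] (f : Z2 G) : Mul (CExt f) :=
  ⟨fun x y => ⟨x.g * y.g, x.n + y.n + f.1 (x.g, y.g)⟩⟩
instance {G : Type*} [Group G] (f : Z2 G) : One (CExt f) := ⟨⟨1, - f.1 (1, 1)⟩⟩
instance {G : Type*} [Group G] (f : Z2 G) : Inv (CExt f) :=
  ⟨fun x => ⟨x.g⁻¹, - x.n - f.1 (x.g⁻¹, x.g) - f.1 (1, 1)⟩⟩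

instance {G : Type*} [Group G] (f : Z2 G) : Group (CExt f) :=
  Group.ofLeftAxioms
    (by
      intro a b c
      ext
      · exact mul_assoc _ _ _
      · have := f.2 a.g b.g c.g
        change a.n + b.n + f.1 (a.g, b.g) + c.n + f.1 (a.g * b.g, c.g) =
          a.n + (b.n + c.n + f.1 (b.g, c.g)) + f.1 (a.g, b.g * c.g)
        linarith)
    (by
      intro a
      ext
      · exact one_mul _
      · have := f.2 1 1 a.g
        change - f.1 (1, 1) + a.n + f.1 (1, a.g) = a.n
        simp only [one_mul] at this
        linarith)
    (by
      intro a
      ext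
      · exact inv_mul_cancel _
      · change - a.n - f.1 (a.g⁻¹, a.g) - f.1 (1, 1) + a.n + f.1 (a.g⁻¹, a.g) = - f.1 (1, 1)
        linarith)

theorem CExt.mul_g {G : Type*} [Group G] {f : Z2 G} (x y : CExt f) : (x * y).g = x.g * y.g := rfl
theorem CExt.mul_n {G : Type*} [Group G] {f : Z2 G} (x y : CExt f) :
    (x * y).n = x.n + y.n + f.1 (x.g, y.g) := rfl
theorem CExt.one_g {G : Type*} [Group G] {f : Z2 G} : (1 : CExt f).g = 1 := rfl
theorem CExt.one_n {G : Type*} [Group G] {f : Z2 G} : (1 : CExt f).n = - f.1 (1, 1) := rfl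

/-- The projection of the central extension. -/
def CExt.proj {G : Type*} [Group G] (f : Z2 G) : CExt f →* G where
  toFun x := x.g
  map_one' := rfl
  map_mul' _ _ := rfl

theorem isD_of_section {G : Type*} [Group G] {f : Z2 G} (ψ : G →* CExt f)
    (h : (CExt.proj f).comp ψ = MonoidHom.id G) : IsD f.1 (fun g => - (ψ g).n) := by
  have h' : ∀ g, (ψ g).g = g := fun g => DFunLike.congr_fun h g
  intro a b
  have := congrArg CExt.n (ψ.map_mul a b)
  rw [CExt.mul_n, h', h'] at this
  linarith

theorem hom_ext_sup {G E : Type*} [Group G] [Group E] {A B : Subgroup G} (hgen : A ⊔ B = ⊤)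
    {f g : G →* E} (hA : ∀ a ∈ A, f a = g a) (hB : ∀ b ∈ B, f b = g b) : f = g := by
  rw [Subgroup.sup_eq_closure] at hgen
  apply MonoidHom.eq_of_eqOn_dense hgen
  rintro x (hx | hx)
  · exact hA x hx
  · exact hB x hx

theorem isD_of_amalgam {G : Type} [Group G] {A B : Subgroup G} (hgen : A ⊔ B = ⊤)
    (hUP : IsAmalgam A B) (f : Z2 G) (φA φB : G → ℤ)
    (hA : ∀ a ∈ A, ∀ b ∈ A, f.1 (a, b) = φA b - φA (a * b) + φA a)
    (hB : ∀ a ∈ B, ∀ b ∈ B, f.1 (a, b) = φB b - φB (a * b) + φB a)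
    (hAB : ∀ c ∈ A, c ∈ B → φA c = φB c) : ∃ φ, IsD f.1 φ := by
  let α : A →* CExt f := MonoidHom.mk' (fun a => ⟨a, - φA a⟩) (by
    intro a b
    have := hA a a.2 b b.2
    ext
    · rfl
    · rw [CExt.mul_n]; push_cast; linarith)
  let β : B →* CExt f := MonoidHom.mk' (fun a => ⟨a, - φB a⟩) (by
    intro a b
    have := hB a a.2 b b.2
    ext
    · rfl
    · rw [CExt.mul_n]; push_cast; linarith)
  obtain ⟨ψ, h1, h2⟩ := hUP (CExt f) α β (by
    intro x ha hb
    ext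
    · rfl
    · simp [α, β, hAB x ha hb])
  refine ⟨_, isD_of_section ψ (hom_ext_sup hgen ?_ ?_)⟩
  · intro a ha
    have := h1 ⟨a, ha⟩
    simp only at this
    simp [this]
    rfl
  · intro a ha
    have := h2 ⟨a, ha⟩
    simp only at this
    simp [this]
    rfl

open ModularGroup in
theorem SL2Z_isD (f : Z2 SL2Z) : ∃ φ, IsD ((12 : ℤ) • f).1 φ := by
  let F : Z2 SL2Z := (12 : ℤ) • f
  have hF : ∀ x, F.1 x = 12 * f.1 x := fun x => by simp [F]
  let s : CExt F := ⟨S, -3 * (2 * f.1 (S, S) + f.1 (S * S, S * S) + f.1 (1, 1))⟩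
  let u : CExt F := ⟨Umat, -2 * (2 * f.1 (Umat, Umat) + 2 * f.1 (Umat * Umat, Umat) +
    f.1 (S * S, S * S) + f.1 (1, 1))⟩
  have e1 : S * S = Umat * Umat * Umat := by decide
  have e2 : S * S * (S * S) = 1 := by decide
  have hs2 : s ^ 2 = u ^ 3 := by
    rw [pow_two, pow_succ, pow_two]
    ext1
    · exact e1
    · simp only [CExt.mul_n, CExt.mul_g, s, u, hF]
      ring
  have hs4 : s ^ 4 = 1 := by
    rw [show 4 = 2 * 2 from rfl, pow_mul, pow_two, pow_two]
    ext1
    · exact e2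
    · simp only [CExt.mul_n, CExt.mul_g, s, hF, CExt.one_n]
      ring
  obtain ⟨ψ, h1, h2⟩ := SL2Z_presentation (CExt F) s u hs4 hs2
  refine ⟨_, isD_of_section ψ (SL2Z_hom_ext ?_ ?_)⟩
  · simp [h1]; rfl
  · simp [h2]; rfl

open ModularGroup in
theorem SL2Z_homZ (φ : HomZ SL2Z) : φ = 0 := by
  have hS : φ.1 S = 0 := by
    have h := congrArg φ.1 (show S * S * (S * S) = 1 by decide)
    simp only [HomZ.mul φ, HomZ.one φ] at h
    omega
  have hU : φ.1 Umat = 0 := by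
    have h := congrArg φ.1 (show S * S = Umat * Umat * Umat by decide)
    simp only [HomZ.mul φ] at h
    omega
  let ψ : SL2Z →* Multiplicative ℤ := MonoidHom.mk' (fun g => Multiplicative.ofAdd (φ.1 g)) (by
    intro a b; rw [HomZ.mul φ]; rfl)
  have : ψ = 1 := SL2Z_hom_ext (by simp [ψ, hS]) (by simp [ψ, hU])
  ext g
  have := DFunLike.congr_fun this g
  exact this

/-- The two properties of the vertex groups that we use. -/
structure VProp (A : Type*) [Group A] : Prop where
  hom : ∀ φ : HomZ A, φ = 0
  tors : ∀ f : Z2 A, ∃ φ, IsD ((12 : ℤ) • f).1 φ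

theorem VProp_SL2Z : VProp SL2Z := ⟨SL2Z_homZ, SL2Z_isD⟩

theorem VProp.of_equiv {A B : Type*} [Group A] [Group B] (e : A ≃* B) (h : VProp A) : VProp B := by
  constructor
  · intro φ
    have := h.hom ⟨fun a => φ.1 (e a), fun a b => by
      simp only [map_mul, HomZ.mul φ]⟩
    ext b
    have := congrFun (congrArg Subtype.val this) (e.symm b)
    simpa using this
  · intro f
    obtain ⟨φ, hφ⟩ := h.tors ⟨fun x => f.1 (e x.1, e x.2), fun a b c => by
      simpa using f.2 (e a) (e b) (e c)⟩
    refine ⟨fun b => φ (e.symm b), fun a b => ?_⟩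
    have := hφ (e.symm a) (e.symm b)
    simpa using this

theorem VProp.unique {A : Type*} [Group A] (h : VProp A) {f : A × A → ℤ} {φ φ' : A → ℤ}
    (h1 : IsD f φ) (h2 : IsD f φ') : φ = φ' := by
  have := h.hom ⟨φ - φ', fun a b => by
    have := h1 a b
    have := h2 a b
    simp only [Pi.sub_apply]
    linarith⟩
  exact sub_eq_zero.1 (congrArg Subtype.val this)

theorem VProp.exists_prim {A : Type*} [Group A] (h : VProp A) :
    ∃ P : Z2 A →ₗ[ℤ] (A → ℤ), ∀ f, IsD ((12 : ℤ) • f).1 (P f) := by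
  choose P hP using h.tors
  refine ⟨{ toFun := P, map_add' := fun f g => ?_, map_smul' := fun c f => ?_ }, hP⟩
  · refine h.unique (hP (f + g)) fun a b => ?_
    have h1 := hP f a b
    have h2 := hP g a b
    simp at h1 h2 ⊢
    linarith
  · refine h.unique (hP (c • f)) fun a b => ?_
    have h1 := hP f a b
    simp at h1 ⊢
    rw [mul_left_comm, h1]
    ring

/-- Restriction of cocycles. -/
def Z2.res {G : Type*} [Group G] (A : Subgroup G) : Z2 G →ₗ[ℤ] Z2 A where
  toFun f := ⟨fun x => f.1 (x.1, x.2), fun a b c => f.2 a b c⟩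
  map_add' _ _ := rfl
  map_smul' _ _ := rfl

/-! ### Wreath-type semidirect products -/

/-- The semidirect product of a group with the functions on a space it acts on. -/
@[ext] structure W (Γ X : Type*) where
  g : Γ
  u : X → ℤ

instance {Γ X : Type*} [Group Γ] [MulAction Γ X] : Mul (W Γ X) :=
  ⟨fun a b => ⟨a.g * b.g, fun x => a.u (b.g • x) + b.u x⟩⟩
instance {Γ X : Type*} [Group Γ] : One (W Γ X) := ⟨⟨1, 0⟩⟩
instance {Γ X : Type*} [Group Γ] [MulAction Γ X] : Inv (W Γ X) :=
  ⟨fun a => ⟨a.g⁻¹, fun x => - a.u (a.g⁻¹ • x)⟩⟩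

theorem W.mul_g {Γ X : Type*} [Group Γ] [MulAction Γ X] (a b : W Γ X) :
    (a * b).g = a.g * b.g := rfl
theorem W.mul_u {Γ X : Type*} [Group Γ] [MulAction Γ X] (a b : W Γ X) (x : X) :
    (a * b).u x = a.u (b.g • x) + b.u x := rfl
theorem W.one_g {Γ X : Type*} [Group Γ] : (1 : W Γ X).g = 1 := rfl
theorem W.one_u {Γ X : Type*} [Group Γ] (x : X) : (1 : W Γ X).u x = 0 := rfl
theorem W.inv_g' {Γ X : Type*} [Group Γ] [MulAction Γ X] (a : W Γ X) : (a⁻¹).g = a.g⁻¹ := rfl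
theorem W.inv_u' {Γ X : Type*} [Group Γ] [MulAction Γ X] (a : W Γ X) (x : X) :
    (a⁻¹).u x = - a.u (a.g⁻¹ • x) := rfl

instance {Γ X : Type*} [Group Γ] [MulAction Γ X] : Group (W Γ X) :=
  Group.ofLeftAxioms
    (by
      intro a b c
      ext
      · exact mul_assoc _ _ _
      · simp only [W.mul_u, W.mul_g, mul_smul]; ring)
    (by
      intro a
      ext
      · exact one_mul _
      · simp [W.mul_u, W.one_u])
    (by
      intro a
      ext
      · exact inv_mul_cancel _
      · simp [W.mul_u, W.inv_u', W.one_u])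

theorem W.inv_g {Γ X : Type*} [Group Γ] [MulAction Γ X] (a : W Γ X) : (a⁻¹).g = a.g⁻¹ := rfl
theorem W.inv_u {Γ X : Type*} [Group Γ] [MulAction Γ X] (a : W Γ X) (x : X) :
    (a⁻¹).u x = - a.u (a.g⁻¹ • x) := rfl

/-- The projection. -/
def W.proj (Γ X : Type*) [Group Γ] [MulAction Γ X] : W Γ X →* Γ where
  toFun a := a.g
  map_one' := rfl
  map_mul' _ _ := rfl

/-- The central subgroup of constants. -/
def W.const (Γ X : Type*) [Group Γ] [MulAction Γ X] : Subgroup (W Γ X) where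
  carrier := {a | a.g = 1 ∧ ∃ k, ∀ x, a.u x = k}
  mul_mem' := by
    rintro a b ⟨h1, k1, h2⟩ ⟨h3, k2, h4⟩
    exact ⟨by simp [W.mul_g, h1, h3], k1 + k2, fun x => by simp [W.mul_u, h2, h4]⟩
  one_mem' := ⟨rfl, 0, fun x => rfl⟩
  inv_mem' := by
    rintro a ⟨h1, k1, h2⟩
    exact ⟨by simp [W.inv_g, h1], - k1, fun x => by simp [W.inv_u, h2]⟩

instance (Γ X : Type*) [Group Γ] [MulAction Γ X] : (W.const Γ X).Normal where
  conj_mem := by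
    rintro a ⟨h1, k, h2⟩ b
    refine ⟨by simp [W.mul_g, W.inv_g, h1], k, fun x => ?_⟩
    simp [W.mul_u, W.inv_u, W.inv_g, h1, h2]

theorem W.mk_eq {Γ X : Type*} [Group Γ] [MulAction Γ X] {a b : W Γ X} :
    (a : W Γ X ⧸ W.const Γ X) = b ↔ a.g = b.g ∧ ∃ k, ∀ x, b.u x = a.u x + k := by
  rw [QuotientGroup.eq]
  constructor
  · rintro ⟨h1, k, h2⟩
    have h3 : a.g = b.g := by
      rw [W.mul_g, W.inv_g] at h1
      exact inv_mul_eq_one.1 h1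
    refine ⟨h3, k, fun x => ?_⟩
    have := h2 x
    simp [W.mul_u, W.inv_u, h3] at this
    linarith
  · rintro ⟨h1, k, h2⟩
    refine ⟨by simp [W.mul_g, W.inv_g, h1], k, fun x => ?_⟩
    simp [W.mul_u, W.inv_u, h1, h2]

theorem exists_equivariant {G : Type*} [Group G] (C : Subgroup G) (h : HomZ C) :
    ∃ F : G → ℤ, ∀ (c : C) (x : G), F (c * x) = F x + h.1 c := by
  let r : G → G := fun x => (Quotient.mk (QuotientGroup.rightRel C) x).out
  have hr : ∀ x, x * (r x)⁻¹ ∈ C := by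
    intro x
    have := Quotient.exact (Quotient.out_eq (Quotient.mk (QuotientGroup.rightRel C) x))
    exact QuotientGroup.rightRel_apply.1 this
  have hr2 : ∀ (c : C) x, r (c * x) = r x := by
    intro c x
    have : Quotient.mk (QuotientGroup.rightRel C) (c * x) =
        Quotient.mk (QuotientGroup.rightRel C) x := by
      apply Quotient.sound
      apply QuotientGroup.rightRel_apply.2
      simp
    simp only [r, this]
  refine ⟨fun x => h.1 ⟨_, hr x⟩, fun c x => ?_⟩
  have h1 : (⟨_, hr (c * x)⟩ : C) = c * ⟨_, hr x⟩ := by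
    ext
    simp [hr2, mul_assoc]
  change h.1 ⟨_, hr (c * x)⟩ = h.1 ⟨_, hr x⟩ + h.1 c
  rw [h1, HomZ.mul h, add_comm]

theorem exists_cocycle {G : Type} [Group G] {A B : Subgroup G} (hgen : A ⊔ B = ⊤)
    (hUP : IsAmalgam A B) (h : HomZ ↥(A ⊓ B)) :
    ∃ (f : Z2 G) (φA φB : G → ℤ),
      (∀ a ∈ A, ∀ b ∈ A, f.1 (a, b) = φA b - φA (a * b) + φA a) ∧
      (∀ a ∈ B, ∀ b ∈ B, f.1 (a, b) = φB b - φB (a * b) + φB a) ∧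
      (∀ c : ↥(A ⊓ B), φA c - φB c = h.1 c) := by
  obtain ⟨F, hF⟩ := exists_equivariant _ h
  let Q := W G G ⧸ W.const G G
  let α : A →* Q := (QuotientGroup.mk' (W.const G G)).comp
    (MonoidHom.mk' (fun a => (⟨a, 0⟩ : W G G)) (fun a b => by
      ext
      · rfl
      · simp [W.mul_u]))
  let β : B →* Q := (QuotientGroup.mk' (W.const G G)).comp
    (MonoidHom.mk' (fun b => (⟨b, fun x => F (b * x) - F x⟩ : W G G)) (fun a b => by
      ext
      · rfl
      · simp [W.mul_u, mul_assoc]))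
  obtain ⟨ψ, h1, h2⟩ := hUP Q α β (by
    intro c ha hb
    refine W.mk_eq.2 ⟨rfl, h.1 ⟨c, ha, hb⟩, fun x => ?_⟩
    have := hF ⟨c, ha, hb⟩ x
    simp at this ⊢
    linarith)
  let pr : Q →* G := QuotientGroup.lift (W.const G G) (W.proj G G) (fun a ha => ha.1)
  have hpr : pr.comp ψ = MonoidHom.id G := by
    apply hom_ext_sup hgen
    · intro a ha
      have := h1 ⟨a, ha⟩
      simp only at this
      simp [this]
      rfl
    · intro a ha
      have := h2 ⟨a, ha⟩
      simp only at this
      simp [this]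
      rfl
  choose w hw using fun g => QuotientGroup.mk_surjective (ψ g)
  have hwg : ∀ g, (w g).g = g := fun g => by
    have := DFunLike.congr_fun hpr g
    simp only [MonoidHom.comp_apply, ← hw] at this
    exact this
  have hmul : ∀ g k, ∃ n, ∀ x, (w g).u (k * x) + (w k).u x = (w (g * k)).u x + n := by
    intro g k
    have : ((w (g * k) : W G G) : Q) = ((w g * w k : W G G) : Q) := by
      rw [QuotientGroup.mk_mul, hw, hw, hw, map_mul]
    obtain ⟨-, n, hn⟩ := W.mk_eq.1 this
    refine ⟨n, fun x => ?_⟩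
    rw [← hn, W.mul_u, hwg]; rfl
  have hA : ∀ a ∈ A, ∃ n, ∀ x, (w a).u x = n := by
    intro a ha
    have : ((⟨a, 0⟩ : W G G) : Q) = (w a : W G G) := by
      rw [hw]; exact (h1 ⟨a, ha⟩).symm
    obtain ⟨-, n, hn⟩ := W.mk_eq.1 this
    exact ⟨n, fun x => by simp [hn]⟩
  have hB : ∀ a ∈ B, ∃ n, ∀ x, (w a).u x = F (a * x) - F x + n := by
    intro a ha
    have : ((⟨a, fun x => F (a * x) - F x⟩ : W G G) : Q) = (w a : W G G) := by
      rw [hw]; exact (h2 ⟨a, ha⟩).symm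
    obtain ⟨-, n, hn⟩ := W.mk_eq.1 this
    exact ⟨n, fun x => by simp [hn]⟩
  choose n hn using hmul
  refine ⟨⟨fun x => n x.1 x.2, ?_⟩, fun g => (w g).u 1, fun g => (w g).u 1 - F g + F 1, ?_, ?_, ?_⟩
  · intro a b c
    have h1 := hn (a * b) c 1
    have h2 := hn a b c
    have h3 := hn b c 1
    have h4 := hn a (b * c) 1
    simp [mul_assoc] at h1 h2 h3 h4 ⊢
    linarith
  · intro a ha b hb
    obtain ⟨k, hk⟩ := hA a ha
    have h1 := hn a b 1
    simp [hk] at h1 ⊢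
    linarith
  · intro a ha b hb
    obtain ⟨k, hk⟩ := hB a ha
    have h1 := hn a b 1
    simp [hk] at h1 ⊢
    linarith
  · intro c
    have := hF c 1
    simp at this ⊢
    linarith

theorem exists_R {G : Type} [Group G] {A B : Subgroup G} (hgen : A ⊔ B = ⊤)
    (hUP : IsAmalgam A B) (hA : VProp A) (hB : VProp B) :
    ∃ R : Z2 G →ₗ[ℤ] HomZ ↥(A ⊓ B),
      (∀ f, R f = 0 ↔ ∃ φ, IsD ((12 : ℤ) • f).1 φ) ∧ ∀ h, ∃ f, R f = (12 : ℤ) • h := by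
  obtain ⟨PA, hPA⟩ := hA.exists_prim
  obtain ⟨PB, hPB⟩ := hB.exists_prim
  let iA : ↥(A ⊓ B) → A := fun c => ⟨c, c.2.1⟩
  let iB : ↥(A ⊓ B) → B := fun c => ⟨c, c.2.2⟩
  let R : Z2 G →ₗ[ℤ] HomZ ↥(A ⊓ B) :=
    { toFun := fun f => ⟨fun c => PA (Z2.res A f) (iA c) - PB (Z2.res B f) (iB c), by
        intro c d
        have h1 := hPA (Z2.res A f) (iA c) (iA d)
        have h2 := hPB (Z2.res B f) (iB c) (iB d)
        simp only [Z2.res, iA, iB, LinearMap.coe_mk, AddHom.coe_mk, Submodule.coe_smul,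
          Pi.smul_apply] at h1 h2
        simp only [iA, iB, Z2.res, LinearMap.coe_mk, AddHom.coe_mk, Subgroup.coe_mul,
          MulMemClass.mk_mul_mk] at h1 h2 ⊢
        linarith⟩
      map_add' := fun f g => by ext c; simp; ring
      map_smul' := fun k f => by ext c; simp; ring }
  have hR : ∀ f c, (R f).1 c = PA (Z2.res A f) (iA c) - PB (Z2.res B f) (iB c) := fun _ _ => rfl
  refine ⟨R, fun f => ⟨fun h0 => ?_, ?_⟩, fun h => ?_⟩
  · classical
    refine isD_of_amalgam hgen hUP _
      (fun g => if hg : g ∈ A then PA (Z2.res A f) ⟨g, hg⟩ else 0)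
      (fun g => if hg : g ∈ B then PB (Z2.res B f) ⟨g, hg⟩ else 0) ?_ ?_ ?_
    · intro a ha b hb
      have h1 := hPA (Z2.res A f) ⟨a, ha⟩ ⟨b, hb⟩
      rw [dif_pos ha, dif_pos hb, dif_pos (A.mul_mem ha hb)]
      exact h1
    · intro a ha b hb
      have h1 := hPB (Z2.res B f) ⟨a, ha⟩ ⟨b, hb⟩
      rw [dif_pos ha, dif_pos hb, dif_pos (B.mul_mem ha hb)]
      exact h1
    · intro c ha hb
      rw [dif_pos ha, dif_pos hb]
      have := hR f ⟨c, ha, hb⟩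
      rw [h0] at this
      exact (sub_eq_zero.1 this.symm)
  · rintro ⟨φ, hφ⟩
    have h1 : PA (Z2.res A f) = fun a : A => φ a :=
      hA.unique (hPA _) (fun a b => hφ a b)
    have h2 : PB (Z2.res B f) = fun a : B => φ a :=
      hB.unique (hPB _) (fun a b => hφ a b)
    ext c
    rw [hR, h1, h2]
    simp [iA, iB]
  · obtain ⟨f, φA, φB, h1, h2, h3⟩ := exists_cocycle hgen hUP h
    refine ⟨f, ?_⟩
    have h4 : PA (Z2.res A f) = fun a : A => 12 * φA a :=
      hA.unique (hPA _) (fun a b => by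
        have := h1 a a.2 b b.2
        change (12 : ℤ) * f.1 (a, b) = _
        rw [this]; push_cast; ring)
    have h5 : PB (Z2.res B f) = fun a : B => 12 * φB a :=
      hB.unique (hPB _) (fun a b => by
        have := h2 a a.2 b b.2
        change (12 : ℤ) * f.1 (a, b) = _
        rw [this]; push_cast; ring)
    ext c
    rw [hR, h4, h5]
    have := h3 c
    simp only [iA, iB]
    change _ = (12 : ℤ) * h.1 c
    rw [← this]; ring

end H2SL2

namespace H2SL2

/-! ### Ranks of kernels of norm maps -/

theorem finrank_ker_two {X : Type*} [Fintype X] (σ : Equiv.Perm X) (h2 : ∀ x, σ (σ x) = x)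
    (N : (X → ℤ) →ₗ[ℤ] (X → ℤ)) (hN : ∀ m x, N m x = m x + m (σ x)) :
    2 * Module.finrank ℤ (LinearMap.ker N) + Nat.card {x // σ x = x} = Fintype.card X := by
  classical
  let e := Fintype.equivFin X
  let R : X → Prop := fun x => e x < e (σ x)
  have ha : ∀ x, R x → ¬ R (σ x) := by
    intro x h h'
    simp only [R, h2] at h h'
    exact lt_asymm h h'
  have hc : ∀ x, R x → σ x ≠ x := by
    intro x h h'
    simp [R, h'] at h
  have hb : ∀ x, σ x ≠ x → R x ∨ R (σ x) := by
    intro x h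
    simp only [R, h2]
    exact lt_or_gt_of_ne (fun h' => h (e.injective h').symm)
  let r : LinearMap.ker N →ₗ[ℤ] ({x // R x} → ℤ) :=
    { toFun := fun m x => m.1 x
      map_add' := fun _ _ => rfl
      map_smul' := fun _ _ => rfl }
  have hker : ∀ m : LinearMap.ker N, ∀ x, m.1 x + m.1 (σ x) = 0 := by
    intro m x
    rw [← hN, LinearMap.mem_ker.1 m.2]; rfl
  have hinj : Function.Injective r := by
    rw [← LinearMap.ker_eq_bot, LinearMap.ker_eq_bot']
    intro m hm
    have h0 : ∀ x, R x → m.1 x = 0 := fun x hx => congrFun hm ⟨x, hx⟩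
    ext x
    change m.1 x = 0
    have := hker m x
    by_cases hx : σ x = x
    · rw [hx] at this; omega
    · rcases hb x hx with h | h
      · exact h0 x h
      · have := h0 _ h; omega
  have hsurj : Function.Surjective r := by
    intro v
    let m : X → ℤ := fun x => if h : R x then v ⟨x, h⟩ else if h : R (σ x) then - v ⟨σ x, h⟩ else 0
    refine ⟨⟨m, ?_⟩, ?_⟩
    · rw [LinearMap.mem_ker]
      ext x
      rw [hN]
      change m x + m (σ x) = 0
      by_cases h : R x
      · simp [m, h, ha x h, h2]
      · by_cases h' : R (σ x)
        · simp [m, h, h']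
        · simp [m, h, h', h2]
    · ext ⟨x, hx⟩
      simp [r, m, hx]
  have hf : Module.finrank ℤ (LinearMap.ker N) = Fintype.card {x // R x} := by
    rw [(LinearEquiv.ofBijective r ⟨hinj, hsurj⟩).finrank_eq]; simp
  rw [hf, Nat.card_eq_fintype_card, Fintype.card_subtype, Fintype.card_subtype, Finset.card_filter,
    Finset.card_filter]
  refine Eq.trans ?_ ((Finset.card_eq_sum_ones (Finset.univ : Finset X)).symm.trans
    Finset.card_univ)
  have h1 : ∑ x, (if R x then 1 else 0) = ∑ x, (if R (σ x) then 1 else 0) :=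
    (Equiv.sum_comp σ (fun x => if R x then 1 else 0)).symm
  rw [two_mul]
  nth_rw 2 [h1]
  rw [← Finset.sum_add_distrib, ← Finset.sum_add_distrib]
  refine Finset.sum_congr rfl fun x _ => ?_
  by_cases hx : σ x = x
  · have h3 : ¬ R x := fun h => hc x h hx
    simp [hx, h3]
  · rcases hb x hx with h | h
    · simp [h, ha x h, hx]
    · have : ¬ R x := fun h' => ha x h' h
      simp [h, this, hx]

theorem finrank_ker_three {X : Type*} [Fintype X] (σ : Equiv.Perm X) (h2 : ∀ x, σ (σ (σ x)) = x)
    (N : (X → ℤ) →ₗ[ℤ] (X → ℤ)) (hN : ∀ m x, N m x = m x + m (σ x) + m (σ (σ x))) :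
    3 * Module.finrank ℤ (LinearMap.ker N) + 2 * Nat.card {x // σ x = x} =
      2 * Fintype.card X := by
  classical
  let e := Fintype.equivFin X
  let R : X → Prop := fun x => e x < e (σ x) ∧ e x < e (σ (σ x))
  have ha : ∀ x, R x → ¬ R (σ x) := by
    intro x h h'
    simp only [R, h2] at h h'
    exact lt_asymm h.1 h'.2
  have ha' : ∀ x, R x → ¬ R (σ (σ x)) := by
    intro x h h'
    simp only [R, h2] at h h'
    exact lt_asymm h.2 h'.1
  have hc : ∀ x, R x → σ x ≠ x := by
    intro x h h'
    simp [R, h'] at h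
  have hb : ∀ x, σ x ≠ x → R x ∨ R (σ x) ∨ R (σ (σ x)) := by
    intro x h
    simp only [R, h2]
    have h3 : e x ≠ e (σ x) := fun h' => h (e.injective h').symm
    have h4 : e (σ x) ≠ e (σ (σ x)) := fun h' => h (σ.injective (e.injective h')).symm
    have h5 : e x ≠ e (σ (σ x)) := fun h' => by
      have h6 := e.injective h'
      have h7 := congrArg σ h6
      rw [h2] at h7
      exact h h7
    generalize e x = a at *
    generalize e (σ x) = b at *
    generalize e (σ (σ x)) = c at *
    omega
  let r : LinearMap.ker N →ₗ[ℤ] ({x // R x} → ℤ) × ({x // R x} → ℤ) :=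
    { toFun := fun m => (fun x => m.1 x, fun x => m.1 (σ x))
      map_add' := fun _ _ => rfl
      map_smul' := fun _ _ => rfl }
  have hker : ∀ m : LinearMap.ker N, ∀ x, m.1 x + m.1 (σ x) + m.1 (σ (σ x)) = 0 := by
    intro m x
    rw [← hN, LinearMap.mem_ker.1 m.2]; rfl
  have hinj : Function.Injective r := by
    rw [← LinearMap.ker_eq_bot, LinearMap.ker_eq_bot']
    intro m hm
    have h0 : ∀ x, R x → m.1 x = 0 := fun x hx => congrFun (congrArg Prod.fst hm) ⟨x, hx⟩
    have h0' : ∀ x, R x → m.1 (σ x) = 0 := fun x hx => congrFun (congrArg Prod.snd hm) ⟨x, hx⟩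
    ext x
    change m.1 x = 0
    have := hker m x
    by_cases hx : σ x = x
    · rw [hx, hx] at this; omega
    · rcases hb x hx with h | h | h
      · exact h0 x h
      · have := h0 _ h; have := h0' _ h; omega
      · have := h0' _ h; rwa [h2] at this
  have hsurj : Function.Surjective r := by
    rintro ⟨v, w⟩
    let m : X → ℤ := fun x => if h : R x then v ⟨x, h⟩ else
      if h : R (σ (σ x)) then w ⟨σ (σ x), h⟩ else
      if h : R (σ x) then - v ⟨σ x, h⟩ - w ⟨σ x, h⟩ else 0
    refine ⟨⟨m, ?_⟩, ?_⟩
    · rw [LinearMap.mem_ker]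
      ext x
      rw [hN]
      change m x + m (σ x) + m (σ (σ x)) = 0
      by_cases h : R x
      · simp [m, h, ha x h, ha' x h, h2]
      · by_cases h' : R (σ x)
        · have := ha _ h'
          simp [m, h, h', this, h2]
          ring
        · by_cases h'' : R (σ (σ x))
          · simp [m, h, h', h'', h2]
          · simp [m, h, h', h'', h2]
    · ext ⟨x, hx⟩
      · simp [r, m, hx]
      · simp [r, m, hx, h2, ha x hx]
  have hf : Module.finrank ℤ (LinearMap.ker N) = 2 * Fintype.card {x // R x} := by
    rw [(LinearEquiv.ofBijective r ⟨hinj, hsurj⟩).finrank_eq, Module.finrank_prod]; simp; ring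
  have key : 3 * Fintype.card {x // R x} + Nat.card {x // σ x = x} = Fintype.card X := by
    rw [Nat.card_eq_fintype_card, Fintype.card_subtype, Fintype.card_subtype, Finset.card_filter,
      Finset.card_filter]
    refine Eq.trans ?_ ((Finset.card_eq_sum_ones (Finset.univ : Finset X)).symm.trans
      Finset.card_univ)
    have h1 : ∑ x, (if R x then 1 else 0) = ∑ x, (if R (σ x) then 1 else 0) :=
      (Equiv.sum_comp σ (fun x => if R x then 1 else 0)).symm
    have h1' : ∑ x, (if R x then 1 else 0) = ∑ x, (if R (σ (σ x)) then 1 else 0) :=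
      h1.trans (Equiv.sum_comp σ (fun x => if R (σ x) then 1 else 0)).symm
    rw [show ∀ k, 3 * k = k + k + k by intro k; ring]
    nth_rw 2 [h1]
    nth_rw 2 [h1']
    rw [← Finset.sum_add_distrib, ← Finset.sum_add_distrib, ← Finset.sum_add_distrib]
    refine Finset.sum_congr rfl fun x _ => ?_
    by_cases hx : σ x = x
    · have h3 : ¬ R x := fun h => hc x h hx
      simp [hx, h3]
    · rcases hb x hx with h | h | h
      · simp [h, ha x h, hx, ha' x h]
      · have h3 : ¬ R x := fun h' => ha x h' h
        simp [h, h3, hx, ha _ h]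
      · have h3 : ¬ R x := fun h' => ha' x h' h
        have h4 : ¬ R (σ x) := fun h' => ha _ h' h
        simp [h, h3, hx, h4]
  rw [hf]
  omega

/-! ### Derivations and the rank of the character group of a point stabilizer -/

/-- Crossed homomorphisms with values in functions on `X`. -/
def Der (Γ X : Type*) [Group Γ] [MulAction Γ X] : Submodule ℤ (Γ → X → ℤ) where
  carrier := {d | ∀ g h x, d (g * h) x = d g (h • x) + d h x}
  add_mem' := by
    intro a b ha hb g h x
    simp only [Pi.add_apply, ha g h, hb g h]; ring
  zero_mem' := by intro g h x; simp
  smul_mem' := by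
    intro c a ha g h x
    simp only [Pi.smul_apply, ha g h, smul_add]

theorem der_mul {Γ X : Type*} [Group Γ] [MulAction Γ X] (d : Der Γ X) (g h : Γ) (x : X) :
    d.1 (g * h) x = d.1 g (h • x) + d.1 h x := d.2 g h x

theorem der_one {Γ X : Type*} [Group Γ] [MulAction Γ X] (d : Der Γ X) (x : X) :
    d.1 1 x = 0 := by
  have := der_mul d 1 1 x
  simp at this
  exact this

/-- Crossed homomorphisms as homomorphisms. -/
def derHom {Γ X : Type*} [Group Γ] [MulAction Γ X] (d : Der Γ X) : Γ →* W Γ X :=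
  MonoidHom.mk' (fun g => ⟨g, d.1 g⟩) (fun g h => by
    ext
    · rfl
    · exact d.2 g h _)

/-- Principal crossed homomorphisms. -/
def princ (Γ X : Type*) [Group Γ] [MulAction Γ X] : (X → ℤ) →ₗ[ℤ] Der Γ X where
  toFun F := ⟨fun g x => F (g • x) - F x, fun g h x => by simp [mul_smul]⟩
  map_add' F F' := by ext g x; simp; ring
  map_smul' c F := by ext g x; simp; ring

/-- Restriction of a crossed homomorphism to a point stabilizer. -/
def evStab (Γ : Type*) {X : Type*} [Group Γ] [MulAction Γ X] (o : X) :
    Der Γ X →ₗ[ℤ] HomZ (MulAction.stabilizer Γ o) where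
  toFun d := ⟨fun c => d.1 c o, fun c c' => by
    have := der_mul d c c' o
    rw [MulAction.mem_stabilizer_iff.1 c'.2] at this
    exact this⟩
  map_add' _ _ := rfl
  map_smul' _ _ := rfl

theorem ker_princ (Γ : Type*) {X : Type*} [Group Γ] [MulAction Γ X] [MulAction.IsPretransitive Γ X]
    (o : X) : Module.finrank ℤ (LinearMap.ker (princ Γ X)) = 1 := by
  let e : LinearMap.ker (princ Γ X) ≃ₗ[ℤ] ℤ :=
    { toFun := fun F => F.1 o
      map_add' := fun _ _ => rfl
      map_smul' := fun _ _ => rfl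
      invFun := fun n => ⟨fun _ => n, by
        rw [LinearMap.mem_ker]; ext; simp [princ]⟩
      left_inv := fun F => by
        ext x
        obtain ⟨g, rfl⟩ := MulAction.exists_smul_eq Γ o x
        have := congrFun (congrFun (congrArg Subtype.val (LinearMap.mem_ker.1 F.2)) g) o
        simp [princ] at this
        change F.1 o = F.1 (g • o)
        linarith
      right_inv := fun n => rfl }
  rw [e.finrank_eq]; simp

theorem ker_evStab (Γ : Type*) {X : Type*} [Group Γ] [MulAction Γ X]
    [MulAction.IsPretransitive Γ X] (o : X) :
    LinearMap.ker (evStab Γ o) = LinearMap.range (princ Γ X) := by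
  apply le_antisymm
  · intro d hd
    have h0 : ∀ c, c • o = o → d.1 c o = 0 := fun c hc =>
      congrFun (congrArg Subtype.val (LinearMap.mem_ker.1 hd)) ⟨c, hc⟩
    choose σ hσ using fun x : X => MulAction.exists_smul_eq Γ o x
    refine ⟨fun x => d.1 (σ x) o, ?_⟩
    ext g x
    change d.1 (σ (g • x)) o - d.1 (σ x) o = d.1 g x
    have h1 := der_mul d g (σ x) o
    have h2 := der_mul d (σ (g • x)) ((σ (g • x))⁻¹ * (g * σ x)) o
    have h3 : ((σ (g • x))⁻¹ * (g * σ x)) • o = o := by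
      rw [mul_smul, mul_smul, hσ, inv_smul_eq_iff, hσ]
    rw [h0 _ h3, h3] at h2
    simp [hσ] at h1 h2
    linarith
  · rintro _ ⟨F, rfl⟩
    rw [LinearMap.mem_ker]
    ext c
    change F (c.1 • o) - F o = 0
    rw [MulAction.mem_stabilizer_iff.1 c.2, sub_self]

theorem evStab_surjective (Γ : Type*) {X : Type*} [Group Γ] [MulAction Γ X]
    [MulAction.IsPretransitive Γ X] (o : X) : Function.Surjective (evStab Γ o) := by
  intro h
  obtain ⟨F₀, hF₀⟩ := exists_equivariant _ h
  let F : Γ → ℤ := fun x => - F₀ x⁻¹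
  have hF : ∀ x c (hc : c ∈ MulAction.stabilizer Γ o), F (x * c) = F x + h.1 ⟨c, hc⟩ := by
    intro x c hc
    have := hF₀ (⟨c, hc⟩⁻¹) x⁻¹
    simp only [F, mul_inv_rev]
    simp only [Subgroup.coe_inv] at this
    rw [this, HomZ.inv h]
    ring
  choose σ hσ using fun x : X => MulAction.exists_smul_eq Γ o x
  have hcos : ∀ x g k, k • o = x → F (g * σ x) - F (σ x) = F (g * k) - F k := by
    intro x g k hk
    have h3 : k⁻¹ * σ x ∈ MulAction.stabilizer Γ o := by
      rw [MulAction.mem_stabilizer_iff, mul_smul, hσ, inv_smul_eq_iff, hk]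
    have h1 := hF (g * k) _ h3
    have h2 := hF k _ h3
    simp [mul_assoc] at h1 h2
    linarith
  refine ⟨⟨fun g x => F (g * σ x) - F (σ x), ?_⟩, ?_⟩
  · intro g k x
    have := hcos (k • x) g (k * σ x) (by rw [mul_smul, hσ])
    simp only [mul_assoc]
    linarith
  · ext c
    change F (c.1 * σ o) - F (σ o) = h.1 c
    rw [hcos o c 1 (by simp)]
    have := hF 1 c c.2
    simp at this ⊢
    linarith

open ModularGroup

/-- Values of crossed homomorphisms on the generators. -/
def evGen (X : Type*) [MulAction SL2Z X] : Der SL2Z X →ₗ[ℤ] (X → ℤ) × (X → ℤ) where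
  toFun d := (d.1 S, d.1 Umat)
  map_add' _ _ := rfl
  map_smul' _ _ := rfl

theorem evGen_injective (X : Type*) [MulAction SL2Z X] : Function.Injective (evGen X) := by
  intro d d' h
  have h1 : d.1 S = d'.1 S := congrArg Prod.fst h
  have h2 : d.1 Umat = d'.1 Umat := congrArg Prod.snd h
  have : derHom d = derHom d' := SL2Z_hom_ext
    (by change (⟨S, d.1 S⟩ : W SL2Z X) = ⟨S, d'.1 S⟩; rw [h1])
    (by change (⟨Umat, d.1 Umat⟩ : W SL2Z X) = ⟨Umat, d'.1 Umat⟩; rw [h2])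
  ext g x
  exact congrFun (congrArg W.u (DFunLike.congr_fun this g)) x

theorem evGen_range (X : Type) [MulAction SL2Z X] (h2 : ∀ x : X, S • S • x = x)
    (NS NU : (X → ℤ) →ₗ[ℤ] (X → ℤ)) (hNS : ∀ m x, NS m x = m x + m (S • x))
    (hNU : ∀ m x, NU m x = m x + m (Umat • x) + m (Umat • Umat • x)) :
    LinearMap.range (evGen X) = (LinearMap.ker NS).prod (LinearMap.ker NU) := by
  have e1 : S * S = Umat * Umat * Umat := by decide
  have e2 : S * S * (S * S) = 1 := by decide
  apply le_antisymm
  · rintro _ ⟨d, rfl⟩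
    have hSS : ∀ x, d.1 (S * S) x = 0 := by
      intro x
      have := der_mul d (S * S) (S * S) x
      rw [e2, der_one, mul_smul, h2] at this
      omega
    rw [Submodule.mem_prod, LinearMap.mem_ker, LinearMap.mem_ker]
    constructor
    · ext x
      rw [hNS]
      have := der_mul d S S x
      rw [hSS] at this
      change d.1 S x + d.1 S (S • x) = 0
      linarith
    · ext x
      rw [hNU]
      have h1 := der_mul d (Umat * Umat) Umat x
      have h3 := der_mul d Umat Umat (Umat • x)
      rw [← e1, hSS] at h1
      change d.1 Umat x + d.1 Umat (Umat • x) + d.1 Umat (Umat • Umat • x) = 0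
      linarith
  · rintro ⟨m, n⟩ hmn
    rw [Submodule.mem_prod, LinearMap.mem_ker, LinearMap.mem_ker] at hmn
    obtain ⟨hm, hn⟩ := hmn
    have hm' : ∀ x, m x + m (S • x) = 0 := fun x => by rw [← hNS]; exact congrFun hm x
    have hn' : ∀ x, n x + n (Umat • x) + n (Umat • Umat • x) = 0 :=
      fun x => by rw [← hNU]; exact congrFun hn x
    let s : W SL2Z X := ⟨S, m⟩
    let u : W SL2Z X := ⟨Umat, n⟩
    have hs : s * s = ⟨S * S, 0⟩ := by
      ext1
      · rfl
      · ext x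
        rw [W.mul_u]
        have := hm' x
        change m (S • x) + m x = 0
        linarith
    have hu : u * u * u = ⟨S * S, 0⟩ := by
      ext1
      · exact e1.symm
      · ext x
        rw [W.mul_u, W.mul_u]
        have := hn' x
        change n (Umat • Umat • x) + n (Umat • x) + n x = 0
        linarith
    obtain ⟨ψ, h3, h4⟩ := SL2Z_presentation (W SL2Z X) s u (by
        rw [show 4 = 2 * 2 from rfl, pow_mul, pow_two, pow_two, hs]
        ext1
        · exact e2
        · ext x; simp [W.mul_u, W.one_u]) (by
        rw [pow_two, pow_succ, pow_two, hs, hu])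
    have hg : (W.proj SL2Z X).comp ψ = MonoidHom.id _ :=
      SL2Z_hom_ext (by simp [h3]; rfl) (by simp [h4]; rfl)
    have hg' : ∀ g, (ψ g).g = g := fun g => DFunLike.congr_fun hg g
    refine ⟨⟨fun g => (ψ g).u, fun g h x => ?_⟩, ?_⟩
    · simp only [map_mul]
      rw [W.mul_u, hg']
    · change ((ψ S).u, (ψ Umat).u) = _
      rw [h3, h4]

theorem finrank_range_ker {M M' : Type*} [AddCommGroup M] [AddCommGroup M'] [Module.Finite ℤ M]
    (f : M →ₗ[ℤ] M') : Module.finrank ℤ (LinearMap.range f) + Module.finrank ℤ (LinearMap.ker f) =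
      Module.finrank ℤ M := by
  rw [← f.quotKerEquivRange.finrank_eq]
  exact Submodule.finrank_quotient_add_finrank (LinearMap.ker f)

theorem finrank_subprod {X : Type*} [Fintype X] (p q : Submodule ℤ (X → ℤ)) :
    Module.finrank ℤ (p.prod q) = Module.finrank ℤ p + Module.finrank ℤ q := by
  let e : (p.prod q) ≃ₗ[ℤ] p × q :=
    { toFun := fun x => (⟨x.1.1, x.2.1⟩, ⟨x.1.2, x.2.2⟩)
      map_add' := fun _ _ => rfl
      map_smul' := fun _ _ => rfl
      invFun := fun x => ⟨(x.1.1, x.2.1), x.1.2, x.2.2⟩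
      left_inv := fun _ => rfl
      right_inv := fun _ => rfl }
  rw [e.finrank_eq, Module.finrank_prod]

theorem finrank_HomZ (X : Type) [Fintype X] [MulAction SL2Z X] [MulAction.IsPretransitive SL2Z X]
    (o : X) (h2 : ∀ x : X, S • S • x = x) :
    Module.Finite ℤ (HomZ (MulAction.stabilizer SL2Z o)) ∧
    6 * Module.finrank ℤ (HomZ (MulAction.stabilizer SL2Z o)) +
      3 * Nat.card {x : X // S • x = x} + 4 * Nat.card {x : X // Umat • x = x} =
        Fintype.card X + 6 := by
  let NS : (X → ℤ) →ₗ[ℤ] (X → ℤ) :=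
    { toFun := fun m x => m x + m (S • x)
      map_add' := fun a b => by ext x; simp; ring
      map_smul' := fun a b => by ext x; simp; ring }
  let NU : (X → ℤ) →ₗ[ℤ] (X → ℤ) :=
    { toFun := fun m x => m x + m (Umat • x) + m (Umat • Umat • x)
      map_add' := fun a b => by ext x; simp; ring
      map_smul' := fun a b => by ext x; simp; ring }
  have h3 : ∀ x : X, Umat • Umat • Umat • x = x := by
    intro x
    have e1 : S * S = Umat * Umat * Umat := by decide
    rw [← mul_smul, ← mul_smul, ← e1, mul_smul, h2]
  have hS := finrank_ker_two (MulAction.toPerm (S : SL2Z)) (X := X) h2 NS (fun _ _ => rfl)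
  have hU := finrank_ker_three (MulAction.toPerm (Umat : SL2Z)) (X := X) h3 NU (fun _ _ => rfl)
  have hr := evGen_range X h2 NS NU (fun _ _ => rfl) (fun _ _ => rfl)
  let eD := LinearEquiv.ofInjective (evGen X) (evGen_injective X)
  have hfin : Module.Finite ℤ (Der SL2Z X) := Module.Finite.equiv eD.symm
  have hfinH : Module.Finite ℤ (HomZ (MulAction.stabilizer SL2Z o)) :=
    Module.Finite.of_surjective _ (evStab_surjective SL2Z o)
  refine ⟨hfinH, ?_⟩
  have r1 : Module.finrank ℤ (Der SL2Z X) = Module.finrank ℤ (LinearMap.ker NS) +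
      Module.finrank ℤ (LinearMap.ker NU) := by
    rw [eD.finrank_eq, hr, finrank_subprod]
  have r2 := finrank_range_ker (evStab SL2Z o)
  have r3 := finrank_range_ker (princ SL2Z X)
  rw [LinearMap.range_eq_top.2 (evStab_surjective SL2Z o), finrank_top, ker_evStab] at r2
  rw [ker_princ SL2Z o, Module.finrank_fintype_fun_eq_card] at r3
  simp only [MulAction.toPerm_apply] at hS hU
  omega

end H2SL2

namespace H2SL2
open Matrix ModularGroup

/-- The special linear group of degree two. -/
abbrev SL2 (R : Type) [CommRing R] := Matrix.SpecialLinearGroup (Fin 2) R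

/-- An element of `SL2` with given entries. -/
def mk2 {R : Type} [CommRing R] (a b c d : R) (h : a * d - b * c = 1) : SL2 R :=
  ⟨!![a, b; c, d], by rw [Matrix.det_fin_two_of, h]⟩

theorem mk2_ext {R : Type} [CommRing R] {g h : SL2 R} (h1 : g 0 0 = h 0 0) (h2 : g 0 1 = h 0 1)
    (h3 : g 1 0 = h 1 0) (h4 : g 1 1 = h 1 1) : g = h := by
  ext i j
  fin_cases i <;> fin_cases j <;> assumption

theorem det_eq {R : Type} [CommRing R] (g : SL2 R) : g 0 0 * g 1 1 - g 0 1 * g 1 0 = 1 := by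
  have := g.2
  rwa [Matrix.det_fin_two] at this

theorem sl_mul {R : Type} [CommRing R] (g h : SL2 R) (i j : Fin 2) :
    (g * h) i j = g i 0 * h 0 j + g i 1 * h 1 j := by
  rw [Matrix.SpecialLinearGroup.coe_mul, Matrix.mul_apply, Fin.sum_univ_two]

@[simp] theorem mk2_00 {R : Type} [CommRing R] (a b c d : R) (h) : mk2 a b c d h 0 0 = a := rfl
@[simp] theorem mk2_01 {R : Type} [CommRing R] (a b c d : R) (h) : mk2 a b c d h 0 1 = b := rfl
@[simp] theorem mk2_10 {R : Type} [CommRing R] (a b c d : R) (h) : mk2 a b c d h 1 0 = c := rfl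
@[simp] theorem mk2_11 {R : Type} [CommRing R] (a b c d : R) (h) : mk2 a b c d h 1 1 = d := rfl

/-- What we need to know about the ring `ℤ[1/p]`. -/
structure LocData (p : ℕ) (R : Type) [CommRing R] where
  q : R
  hq : (p : R) * q = 1
  frac : ∀ r : R, ∃ (n : ℤ) (k : ℕ), r * (p : R) ^ k = n
  ι : R →+* ℚ
  inj : Function.Injective ι

section
variable {p : ℕ} {R : Type} [CommRing R]

theorem LocData.int_inj (L : LocData p R) {m n : ℤ} (h : (m : R) = n) : m = n := by
  have := congrArg L.ι h
  simpa using this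

/-- The first copy of `SL2Z`. -/
def iA (R : Type) [CommRing R] : SL2Z →* SL2 R := Matrix.SpecialLinearGroup.map (Int.castRingHom R)

theorem iA_apply (g : SL2Z) (i j : Fin 2) : iA R g i j = (g i j : R) := rfl

/-- The second copy of `SL2Z`. -/
def iB (L : LocData p R) : SL2Z →* SL2 R :=
  MonoidHom.mk' (fun g => mk2 (g 0 0 : R) (g 0 1 * L.q) (p * g 1 0) (g 1 1) (by
    have := congrArg (Int.cast : ℤ → R) (det_eq g)
    push_cast at this
    linear_combination this - g 0 1 * g 1 0 * L.hq)) (fun g h => by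
    have := L.hq
    apply mk2_ext
    · simp [sl_mul]
      linear_combination -(g 0 1 * h 1 0 : R) * L.hq
    · simp [sl_mul]; ring
    · simp [sl_mul]; ring
    · simp [sl_mul]
      linear_combination -(g 1 0 * h 0 1 : R) * L.hq)

theorem iB_apply (L : LocData p R) (g : SL2Z) : iB L g = mk2 (g 0 0 : R) (g 0 1 * L.q) (p * g 1 0) (g 1 1) (by
    have := congrArg (Int.cast : ℤ → R) (det_eq g)
    push_cast at this
    linear_combination this - g 0 1 * g 1 0 * L.hq) := rfl

theorem iA_inj (L : LocData p R) : Function.Injective (iA R) := by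
  intro g h e
  have : ∀ i j, g i j = h i j := fun i j => L.int_inj (by rw [← iA_apply, ← iA_apply, e])
  ext i j; exact this i j

theorem iB_inj (L : LocData p R) : Function.Injective (iB L) := by
  intro g h e
  have e1 := congrArg (fun x : SL2 R => x 0 0) e
  have e2 := congrArg (fun x : SL2 R => x 0 1) e
  have e3 := congrArg (fun x : SL2 R => x 1 0) e
  have e4 := congrArg (fun x : SL2 R => x 1 1) e
  simp only [iB_apply, mk2_00, mk2_01, mk2_10, mk2_11] at e1 e2 e3 e4
  apply mk2_ext
  · exact L.int_inj e1
  · refine L.int_inj ?_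
    linear_combination p * e2 - (g 0 1 : R) * L.hq + (h 0 1 : R) * L.hq
  · refine L.int_inj ?_
    linear_combination L.q * e3 - (g 1 0 : R) * L.hq + (h 1 0 : R) * L.hq
  · exact L.int_inj e4

/-- The subgroup `A`. -/
def subA (R : Type) [CommRing R] : Subgroup (SL2 R) := (iA R).range
/-- The subgroup `B`. -/
def subB (L : LocData p R) : Subgroup (SL2 R) := (iB L).range

theorem iA_mem_B (L : LocData p R) (g : SL2Z) : iA R g ∈ subB L ↔ (p : ℤ) ∣ g 1 0 := by
  constructor
  · rintro ⟨h, e⟩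
    have e3 := congrArg (fun x : SL2 R => x 1 0) e
    simp only [iB_apply, mk2_10, iA_apply] at e3
    exact ⟨h 1 0, (L.int_inj (by push_cast; exact e3)).symm⟩
  · rintro ⟨k, hk⟩
    refine ⟨mk2 (g 0 0) (p * g 0 1) k (g 1 1) ?_, ?_⟩
    · have := det_eq g
      rw [hk] at this
      linear_combination this
    · rw [iB_apply]
      apply mk2_ext <;> simp only [mk2_00, mk2_01, mk2_10, mk2_11, iA_apply, hk] <;> push_cast
      · linear_combination (g 0 1 : R) * L.hq
      · rfl

theorem iB_mem_A (L : LocData p R) (g : SL2Z) (hd : (p : ℤ) ∣ g 0 1) : iB L g ∈ subA R := by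
  obtain ⟨k, hk⟩ := hd
  refine ⟨mk2 (g 0 0) k (p * g 1 0) (g 1 1) ?_, ?_⟩
  · have := det_eq g
    rw [hk] at this
    linear_combination this
  · rw [iB_apply]
    apply mk2_ext <;> simp only [mk2_00, mk2_01, mk2_10, mk2_11, iA_apply, hk] <;> push_cast
    · linear_combination -(k : R) * L.hq
    · rfl

/-- The ping-pong data. -/
def pingG (L : LocData p R) [hp : Fact p.Prime] : PingPong (subA R) (subB L) where
  Y := ℚ × ℚ
  act g v := (L.ι (g 0 0) * v.1 + L.ι (g 0 1) * v.2, L.ι (g 1 0) * v.1 + L.ι (g 1 1) * v.2)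
  act_mul g h v := by ext <;> simp [sl_mul] <;> ring
  act_one v := by ext <;> simp
  N v := max (padicNorm p v.1) (padicNorm p v.2)
  P v := padicNorm p v.1 ≤ padicNorm p v.2 ∧ v.2 ≠ 0
  Q v := padicNorm p v.2 < padicNorm p v.1
  exP := ⟨(0, 1), by simp⟩
  exQ := ⟨(1, 0), by simp⟩
  stepA := by
    rintro _ ⟨g, rfl⟩ hb ⟨x, y⟩ hQ
    rw [iA_mem_B, ← padicNorm.int_eq_one_iff] at hb
    simp only [iA_apply, map_intCast] at hQ ⊢
    have hx : 0 < padicNorm p x := (padicNorm.nonneg _).trans_lt hQ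
    have mulle : ∀ (n : ℤ) (z : ℚ), padicNorm p (n * z) ≤ padicNorm p z := by
      intro n z
      rw [padicNorm.mul]
      exact mul_le_of_le_one_left (padicNorm.nonneg _) (padicNorm.of_int _)
    have h1 : padicNorm p (g 1 0 * x) = padicNorm p x := by rw [padicNorm.mul, hb, one_mul]
    have h2 : padicNorm p (g 1 1 * y) < padicNorm p x := (mulle _ _).trans_lt hQ
    have h3 : padicNorm p (g 1 0 * x + g 1 1 * y) = padicNorm p x := by
      rw [padicNorm.add_eq_max_of_ne (by rw [h1]; exact h2.ne'), h1, max_eq_left h2.le]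
    have h4 : padicNorm p (g 0 0 * x + g 0 1 * y) ≤ padicNorm p x :=
      padicNorm.nonarchimedean.trans (max_le (mulle _ _) ((mulle _ _).trans hQ.le))
    refine ⟨⟨by rw [h3]; exact h4, ?_⟩, ?_⟩
    · intro h0
      rw [h0, padicNorm.zero] at h3
      linarith
    · rw [h3, max_eq_left hQ.le]
      exact le_max_right _ _
  stepB := by
    rintro _ ⟨g, rfl⟩ hb ⟨x, y⟩ ⟨hP, hy⟩
    have hb' : padicNorm p (g 0 1) = 1 := by
      rw [padicNorm.int_eq_one_iff]
      exact fun h => hb (iB_mem_A L g h)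
    have p0 : (p : ℚ) ≠ 0 := by exact_mod_cast hp.1.ne_zero
    have p1 : (1 : ℚ) < p := by exact_mod_cast hp.1.one_lt
    have hιq : L.ι L.q = (p : ℚ)⁻¹ := by
      have := congrArg L.ι L.hq
      simp only [map_mul, map_natCast, map_one] at this
      exact eq_inv_of_mul_eq_one_right this
    simp only [iB_apply, mk2_00, mk2_01, mk2_10, mk2_11, map_mul, map_intCast, map_natCast, hιq]
      at hP hy ⊢
    have hy' : 0 < padicNorm p y := lt_of_le_of_ne (padicNorm.nonneg _) (padicNorm.nonzero hy).symm
    have mulle : ∀ (n : ℤ) (z : ℚ), padicNorm p (n * z) ≤ padicNorm p z := by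
      intro n z
      rw [padicNorm.mul]
      exact mul_le_of_le_one_left (padicNorm.nonneg _) (padicNorm.of_int _)
    have hpinv : padicNorm p (p : ℚ)⁻¹ = p := by
      have := padicNorm.div (p := p) 1 (p : ℚ)
      rw [padicNorm.padicNorm_p_of_prime, padicNorm.one, one_div, one_div, inv_inv] at this
      exact this
    have h1 : padicNorm p (g 0 1 * (p : ℚ)⁻¹ * y) = p * padicNorm p y := by
      rw [padicNorm.mul, padicNorm.mul, hb', one_mul, hpinv]
    have hlt : padicNorm p y < p * padicNorm p y := by nlinarith
    have h2 : padicNorm p (g 0 0 * x) < p * padicNorm p y := ((mulle _ _).trans hP).trans_lt hlt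
    have h3 : padicNorm p (g 0 0 * x + g 0 1 * (p : ℚ)⁻¹ * y) = p * padicNorm p y := by
      rw [padicNorm.add_eq_max_of_ne (by rw [h1]; exact h2.ne), h1, max_eq_right h2.le]
    have h4 : padicNorm p (p * g 1 0 * x + g 1 1 * y) ≤ padicNorm p y := by
      refine padicNorm.nonarchimedean.trans (max_le ?_ (mulle _ _))
      have := mulle (p * g 1 0) x
      push_cast at this
      exact this.trans hP
    refine ⟨by rw [h3]; exact h4.trans_lt hlt, ?_⟩
    rw [h3, max_eq_right hP]
    exact hlt.trans_le (le_max_left _ _)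

theorem LocData.pq_pow (L : LocData p R) (k : ℕ) : (p : R) ^ k * L.q ^ k = 1 := by
  rw [← mul_pow, L.hq, one_pow]

theorem gen_top (L : LocData p R) (hp : p.Prime) : subA R ⊔ subB L = ⊤ := by
  set H := subA R ⊔ subB L with hH
  have hA : ∀ g, iA R g ∈ H := fun g => Subgroup.mem_sup_left ⟨g, rfl⟩
  have hB : ∀ g, iB L g ∈ H := fun g => Subgroup.mem_sup_right ⟨g, rfl⟩
  have hD : ∀ k : ℕ, mk2 ((p : R) ^ k) 0 0 (L.q ^ k) (by rw [L.pq_pow]; ring) ∈ H := by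
    intro k
    induction k with
    | zero =>
      convert H.one_mem using 1
      apply mk2_ext <;> simp
    | succ k ih =>
      convert H.mul_mem ih (H.mul_mem (hA (mk2 0 1 (-1) 0 (by norm_num)))
        (hB (mk2 0 (-1) 1 0 (by norm_num)))) using 1
      apply mk2_ext <;> simp [sl_mul, iA_apply, iB_apply, pow_succ]
  have hD' : ∀ k : ℕ, mk2 (L.q ^ k) 0 0 ((p : R) ^ k)
      (by rw [mul_comm, L.pq_pow]; ring) ∈ H := by
    intro k
    convert H.inv_mem (hD k) using 1
    rw [eq_inv_iff_mul_eq_one]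
    have := L.pq_pow k
    apply mk2_ext <;> simp [sl_mul]
    · rwa [mul_comm]
    · exact this
  have hE : ∀ m : R, mk2 1 m 0 1 (by ring) ∈ H := by
    intro m
    obtain ⟨n, t, ht⟩ := L.frac m
    convert H.mul_mem (H.mul_mem (hD' t) (hA (mk2 1 (n * p ^ t) 0 1 (by ring)))) (hD t) using 1
    have := L.pq_pow t
    apply mk2_ext <;> simp [sl_mul, iA_apply]
    · linear_combination -this
    · linear_combination (L.q ^ t * L.q ^ t * (p : R) ^ t) * ht -
        (m + m * (p : R) ^ t * L.q ^ t) * this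
    · linear_combination -this
  rw [eq_top_iff]
  intro g _
  obtain ⟨n1, k1, h1⟩ := L.frac (g 0 0)
  obtain ⟨n2, k2, h2⟩ := L.frac (g 1 0)
  obtain ⟨k, x, y, hx, hy⟩ : ∃ (k : ℕ) (x y : ℤ), g 0 0 * (p : R) ^ k = x ∧
      g 1 0 * (p : R) ^ k = y := by
    refine ⟨k1 + k2, n1 * p ^ k2, n2 * p ^ k1, ?_, ?_⟩
    · push_cast; rw [← h1]; ring
    · push_cast; rw [← h2]; ring
  have hdet := det_eq g
  have hpk := L.pq_pow k
  have hne : (Int.gcd x y : ℤ) ≠ 0 := by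
    intro h0
    have h0' : Int.gcd x y = 0 := by exact_mod_cast h0
    rw [Int.gcd_eq_zero_iff] at h0'
    rw [h0'.1, Int.cast_zero] at hx
    rw [h0'.2, Int.cast_zero] at hy
    have e1 : g 0 0 = 0 := by linear_combination L.q ^ k * hx - g 0 0 * hpk
    have e2 : g 1 0 = 0 := by linear_combination L.q ^ k * hy - g 1 0 * hpk
    rw [e1, e2] at hdet
    have : (0 : ℤ) = 1 := L.int_inj (by push_cast; linear_combination hdet)
    omega
  obtain ⟨x', hx'⟩ := Int.gcd_dvd_left x y
  obtain ⟨y', hy'⟩ := Int.gcd_dvd_right x y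
  have hbez := Int.gcd_eq_gcd_ab x y
  set d : ℕ := Int.gcd x y with hd
  set u := Int.gcdA x y
  set v := Int.gcdB x y
  have hdet' : u * x' - v * (-y') = 1 := by
    apply mul_left_cancel₀ hne
    linear_combination -hbez - u * hx' - v * hy'
  have hxR : (x : R) = d * x' := by rw [hx']; push_cast; rfl
  have hyR : (y : R) = d * y' := by rw [hy']; push_cast; rfl
  have hbR : (d : R) = x * u + y * v := by
    have := congrArg (Int.cast : ℤ → R) hbez; push_cast at this; exact this
  have hg00 : g 0 0 = x * L.q ^ k := by linear_combination L.q ^ k * hx - g 0 0 * hpk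
  have hg10 : g 1 0 = y * L.q ^ k := by linear_combination L.q ^ k * hy - g 1 0 * hpk
  set γ : SL2Z := mk2 u v (-y') x' hdet' with hγ
  set g' := iA R γ * g with hg'
  have e00 : g' 0 0 = d * L.q ^ k := by
    simp [hg', sl_mul, iA_apply, hγ, hg00, hg10]
    rw [hbR]; ring
  have e10 : g' 1 0 = 0 := by
    simp [hg', sl_mul, iA_apply, hγ, hg00, hg10]
    rw [hxR, hyR]; ring
  have hdet2 := det_eq g'
  rw [e00, e10] at hdet2
  obtain ⟨n, l, hn⟩ := L.frac (g' 1 1)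
  have hdvd : (d : ℤ) * n = p ^ (k + l) := L.int_inj (by
    push_cast
    rw [← hn]
    linear_combination (p : R) ^ (k + l) * hdet2 - (d : R) * g' 1 1 * p ^ l * hpk)
  have hdvd' : d ∣ p ^ (k + l) := by
    have : (d : ℤ) ∣ ((p ^ (k + l) : ℕ) : ℤ) := ⟨n, by push_cast; exact hdvd.symm⟩
    exact_mod_cast this
  obtain ⟨j, -, hj⟩ := (Nat.dvd_prime_pow hp).1 hdvd'
  have hdj : (d : R) = p ^ j := by rw [hj]; push_cast; rfl
  rw [hdj] at e00 hdet2
  have hpj := L.pq_pow j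
  let a1 := mk2 (L.q ^ j) 0 0 ((p : R) ^ j) (by rw [mul_comm, L.pq_pow]; ring)
  let a2 := mk2 ((p : R) ^ k) 0 0 (L.q ^ k) (by rw [L.pq_pow]; ring)
  have hfin : a1 * (a2 * g') = mk2 1 (L.q ^ j * (p ^ k * g' 0 1)) 0 1 (by ring) := by
    apply mk2_ext
    · simp [a1, a2, sl_mul, e00]
      linear_combination (L.q ^ j * p ^ j : R) * hpk + hpj
    · simp [a1, a2, sl_mul]
    · simp [a1, a2, sl_mul, e10]
    · simp [a1, a2, sl_mul]
      linear_combination hdet2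
  have hmem : a1 * (a2 * g') ∈ H := by rw [hfin]; exact hE _
  rw [H.mul_mem_cancel_left (hD' j), H.mul_mem_cancel_left (hD k), hg',
    H.mul_mem_cancel_left (hA γ)] at hmem
  exact hmem

theorem isAmalgam_G (L : LocData p R) (hp : p.Prime) : IsAmalgam (subA R) (subB L) := by
  have : Fact p.Prime := ⟨hp⟩
  exact (pingG L).isAmalgam (gen_top L hp)

theorem VProp_A (L : LocData p R) : VProp (subA R) :=
  VProp_SL2Z.of_equiv (MonoidHom.ofInjective (iA_inj L))

theorem VProp_B (L : LocData p R) : VProp (subB L) :=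
  VProp_SL2Z.of_equiv (MonoidHom.ofInjective (iB_inj L))

end

/-- The localization satisfies our requirements. -/
noncomputable def locData (p : ℕ) (hp : p.Prime) : LocData p (Localization.Away (p : ℤ)) where
  q := IsLocalization.Away.invSelf (p : ℤ)
  hq := by
    have := IsLocalization.Away.mul_invSelf (S := Localization.Away (p : ℤ)) (p : ℤ)
    simpa using this
  frac r := by
    obtain ⟨⟨a, s⟩, h⟩ := IsLocalization.surj (Submonoid.powers (p : ℤ)) r
    obtain ⟨k, hk⟩ := s.2
    refine ⟨a, k, ?_⟩
    have hk' : (s : ℤ) = p ^ k := hk.symm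
    rw [hk'] at h
    simpa using h
  ι := IsLocalization.Away.lift (S := Localization.Away (p : ℤ)) (g := Int.castRingHom ℚ) (p : ℤ)
    (by simpa using hp.ne_zero)
  inj := by
    rw [injective_iff_map_eq_zero]
    intro r hr
    obtain ⟨⟨a, s⟩, h⟩ := IsLocalization.surj (Submonoid.powers (p : ℤ)) r
    have h2 := congrArg (IsLocalization.Away.lift (S := Localization.Away (p : ℤ))
      (g := Int.castRingHom ℚ) (p : ℤ) (by simpa using hp.ne_zero)) h
    rw [map_mul, hr, zero_mul, IsLocalization.Away.lift_eq] at h2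
    have ha : a = 0 := by simpa using h2.symm
    subst ha
    rw [map_zero] at h
    exact (IsLocalization.map_units (Localization.Away (p : ℤ)) s).mul_left_eq_zero.1 h

end H2SL2

namespace H2SL2
open Matrix ModularGroup OnePoint

/-- The projective line over `ZMod p`. -/
def PL (p : ℕ) : Type := OnePoint (ZMod p)

section
variable (p : ℕ) [hp : Fact p.Prime]

instance : Fintype (PL p) := inferInstanceAs (Fintype (OnePoint (ZMod p)))

/-- Reduction mod `p`. -/
noncomputable def redGL : SL2Z →* GL (Fin 2) (ZMod p) :=
  (Matrix.SpecialLinearGroup.toGL).comp (Matrix.SpecialLinearGroup.map (Int.castRingHom (ZMod p)))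

/-- The point at infinity. -/
def PL.inf : PL p := (∞ : OnePoint (ZMod p))
variable {p} in
/-- Finite points. -/
def PL.pt (k : ZMod p) : PL p := (k : OnePoint (ZMod p))

variable {p} in
theorem PL.pt_inj {k l : ZMod p} : PL.pt k = PL.pt l ↔ k = l := OnePoint.coe_eq_coe
variable {p} in
theorem PL.pt_ne (k : ZMod p) : PL.pt k ≠ PL.inf p := OnePoint.coe_ne_infty k

theorem PL.cases (x : PL p) : x = PL.inf p ∨ ∃ k, x = PL.pt k := by
  change OnePoint (ZMod p) at x
  cases x with
  | infty => exact .inl rfl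
  | coe k => exact .inr ⟨k, rfl⟩

noncomputable instance : MulAction SL2Z (PL p) :=
  MulAction.compHom (OnePoint (ZMod p)) (redGL p)

theorem redGL_apply (g : SL2Z) (i j : Fin 2) : redGL p g i j = (g i j : ZMod p) := rfl

theorem PL_infty (g : SL2Z) : g • PL.inf p =
    if (g 1 0 : ZMod p) = 0 then PL.inf p else PL.pt (g 0 0 / g 1 0 : ZMod p) :=
  (smul_infty_eq_ite (redGL p g))

theorem PL_coe (g : SL2Z) (k : ZMod p) :
    g • PL.pt k =
    if (g 1 0 * k + g 1 1 : ZMod p) = 0 then PL.inf p else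
      PL.pt ((g 0 0 * k + g 0 1) / (g 1 0 * k + g 1 1) : ZMod p) :=
  (smul_some_eq_ite (g := redGL p g) (k := k))

theorem PL_S_infty : (S : SL2Z) • PL.inf p = PL.pt 0 := by
  rw [PL_infty]
  simp [S]

theorem PL_S_coe (k : ZMod p) :
    (S : SL2Z) • PL.pt k = if k = 0 then PL.inf p else PL.pt (-1 / k : ZMod p) := by
  rw [PL_coe]
  simp [S]

theorem Umat_eq : Umat = mk2 0 (-1) 1 1 (by norm_num) := by decide

theorem PL_U_infty : (Umat : SL2Z) • PL.inf p = PL.pt 0 := by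
  rw [PL_infty, Umat_eq]
  simp

theorem PL_U_coe (k : ZMod p) :
    (Umat : SL2Z) • PL.pt k =
    if k + 1 = 0 then PL.inf p else PL.pt (-1 / (k + 1) : ZMod p) := by
  rw [PL_coe, Umat_eq]
  simp

theorem PL_SS (x : PL p) : (S : SL2Z) • (S : SL2Z) • x = x := by
  have e : (S : SL2Z) * S = mk2 (-1) 0 0 (-1) (by norm_num) := by decide
  rw [← mul_smul, e]
  obtain rfl | ⟨k, rfl⟩ := PL.cases p x
  · rw [PL_infty]; simp
  · rw [PL_coe]; simp

instance : MulAction.IsPretransitive SL2Z (PL p) := by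
  rw [MulAction.isPretransitive_iff_base (PL.inf p)]
  intro x
  obtain rfl | ⟨k, rfl⟩ := PL.cases p x
  · exact ⟨1, one_smul _ _⟩
  · refine ⟨mk2 k.val (-1) 1 0 (by ring), ?_⟩
    rw [PL_infty]
    simp

theorem mem_stab (g : SL2Z) : g ∈ MulAction.stabilizer SL2Z (PL.inf p) ↔ (p : ℤ) ∣ g 1 0 := by
  rw [MulAction.mem_stabilizer_iff, ← ZMod.intCast_zmod_eq_zero_iff_dvd, PL_infty]
  split_ifs with h
  · simp [h]
  · simp [h, PL.pt_ne]

theorem card_PL : Fintype.card (PL p) = p + 1 := by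
  have := (Fintype.card_option (α := ZMod p))
  rw [ZMod.card] at this
  rw [← this]
  exact Fintype.card_congr (Equiv.refl _)

theorem card_fix {P : PL p → Prop} (h0 : ¬ P (PL.inf p)) :
    Nat.card {x : PL p // P x} =
      Set.ncard {k : ZMod p | P (PL.pt k)} := by
  rw [← Set.ncard_image_of_injective _ (f := PL.pt) (fun k l h => PL.pt_inj.1 h)]
  change Set.ncard {x : PL p | P x} = _
  congr 1
  ext x
  obtain rfl | ⟨k, rfl⟩ := PL.cases p x
  · simp [h0, PL.pt_ne]
  · simp [PL.pt_inj]

theorem fix_S : {k : ZMod p | (S : SL2Z) • (PL.pt k) =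
    (PL.pt k)} = {k | k * k = -1} := by
  ext k
  simp only [Set.mem_ofPred_eq, PL_S_coe]
  by_cases hk : k = 0
  · subst hk
    simp
    exact (PL.pt_ne _).symm
  · rw [if_neg hk]
    rw [PL.pt_inj, div_eq_iff hk, eq_comm]

theorem fix_U : {k : ZMod p | (Umat : SL2Z) • (PL.pt k) =
    (PL.pt k)} = {k | k * k + k + 1 = 0} := by
  ext k
  simp only [Set.mem_ofPred_eq, PL_U_coe]
  by_cases hk : k + 1 = 0
  · have : k = -1 := by linear_combination hk
    subst this
    simp [(PL.pt_ne _).symm]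
  · rw [if_neg hk]
    rw [PL.pt_inj, div_eq_iff hk]
    constructor <;> intro h
    · linear_combination -h
    · linear_combination -h

theorem ne_zero_of_lt {n : ℕ} (h0 : 0 < n) (h : n < p) : ((n : ℕ) : ZMod p) ≠ 0 := by
  rw [Ne, ZMod.natCast_eq_zero_iff]
  exact fun h' => absurd (Nat.le_of_dvd h0 h') (not_le.2 h)

theorem nu2 (h3 : 3 < p) : Nat.card {x : PL p // (S : SL2Z) • x = x} =
    if p % 4 = 1 then 2 else 0 := by
  rw [card_fix p (by rw [PL_S_infty]; exact PL.pt_ne _), fix_S]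
  have two : (2 : ZMod p) ≠ 0 := by
    have := ne_zero_of_lt p (n := 2) (by norm_num) (by omega)
    exact_mod_cast this
  have hodd : p % 2 = 1 := hp.1.eq_two_or_odd.resolve_left (by omega)
  split_ifs with h
  · obtain ⟨y, hy⟩ := (ZMod.exists_sq_eq_neg_one_iff (p := p)).2 (by omega)
    have hy0 : y ≠ -y := by
      intro e
      have e2 : 2 * y = 0 := by linear_combination e
      have : y = 0 := (mul_eq_zero.1 e2).resolve_left two
      rw [this] at hy
      simp at hy
    rw [← Set.ncard_pair hy0]
    congr 1
    ext k
    simp only [Set.mem_ofPred_eq, Set.mem_insert_iff, Set.mem_singleton_iff]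
    rw [hy, mul_self_eq_mul_self_iff]
  · convert Set.ncard_empty (ZMod p)
    rw [Set.eq_empty_iff_forall_notMem]
    intro k hk
    have := (ZMod.exists_sq_eq_neg_one_iff (p := p)).1 ⟨k, hk.symm⟩
    omega

theorem nu3 (h3 : 3 < p) : Nat.card {x : PL p // (Umat : SL2Z) • x = x} =
    if p % 3 = 1 then 2 else 0 := by
  rw [card_fix p (by rw [PL_U_infty]; exact PL.pt_ne _), fix_U]
  have three : (3 : ZMod p) ≠ 0 := by
    have := ne_zero_of_lt p (n := 3) (by norm_num) (by omega)
    exact_mod_cast this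
  have hcard : Fintype.card (ZMod p)ˣ = p - 1 := ZMod.card_units p
  have : Fact (Nat.Prime 3) := ⟨Nat.prime_three⟩
  split_ifs with h
  · obtain ⟨z, hz⟩ := exists_prime_orderOf_dvd_card (G := (ZMod p)ˣ) 3 (by rw [hcard]; omega)
    have hz3 : (z : ZMod p) ^ 3 = 1 := by
      rw [← Units.val_pow_eq_pow_val, ← hz, pow_orderOf_eq_one]; rfl
    have hz1 : (z : ZMod p) ≠ 1 := by
      intro e
      have : z = 1 := Units.ext e
      rw [this, orderOf_one] at hz
      omega
    set x : ZMod p := (z : ZMod p)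
    have hx : x * x + x + 1 = 0 := by
      have : (x - 1) * (x * x + x + 1) = 0 := by linear_combination hz3
      exact (mul_eq_zero.1 this).resolve_left (sub_ne_zero.2 hz1)
    have hne : x ≠ -1 - x := by
      intro e
      apply three
      linear_combination 4 * hx - (2 * x + 1) * e
    rw [← Set.ncard_pair hne]
    congr 1
    ext k
    simp only [Set.mem_ofPred_eq, Set.mem_insert_iff, Set.mem_singleton_iff]
    constructor
    · intro hk
      have : (k - x) * (k - (-1 - x)) = 0 := by linear_combination hk - hx
      rcases mul_eq_zero.1 this with e | e
      · exact .inl (sub_eq_zero.1 e)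
      · exact .inr (sub_eq_zero.1 e)
    · rintro (rfl | rfl)
      · exact hx
      · linear_combination hx
  · convert Set.ncard_empty (ZMod p)
    rw [Set.eq_empty_iff_forall_notMem]
    intro k hk
    have hk' : k * k + k + 1 = 0 := hk
    have hk3 : k ^ 3 = 1 := by linear_combination (k - 1) * hk'
    have hk1 : k ≠ 1 := by
      rintro rfl
      apply three
      linear_combination hk'
    let z : (ZMod p)ˣ := Units.mkOfMulEqOne k (k ^ 2) (by linear_combination hk3)
    have hz : orderOf z = 3 := orderOf_eq_prime (by ext; exact hk3) (by
      intro e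
      exact hk1 (congrArg Units.val e))
    have := orderOf_dvd_card (x := z)
    rw [hz, hcard] at this
    have hp3 : ¬ 3 ∣ p := fun h' => by
      have := (Nat.prime_dvd_prime_iff_eq Nat.prime_three hp.1).1 h'
      omega
    omega

end

/-- Functoriality of `HomZ`. -/
def HomZ.congr {A B : Type*} [Group A] [Group B] (e : A ≃* B) : HomZ A ≃ₗ[ℤ] HomZ B where
  toFun φ := ⟨fun b => φ.1 (e.symm b), fun g h => by
    change φ.1 _ = φ.1 _ + φ.1 _
    rw [map_mul]; exact φ.2 _ _⟩
  map_add' _ _ := rfl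
  map_smul' _ _ := rfl
  invFun φ := ⟨fun a => φ.1 (e a), fun g h => by
    change φ.1 _ = φ.1 _ + φ.1 _
    rw [map_mul]; exact φ.2 _ _⟩
  left_inv φ := by ext a; simp
  right_inv φ := by ext a; simp

theorem finrank_C {p : ℕ} {R : Type} [CommRing R] (L : LocData p R) (hp : p.Prime) (hp3 : 3 < p)
    (N : ℕ)
    (hN : (p % 12 = 1 ∧ N = (p - 7) / 6) ∨ (p % 12 = 5 ∧ N = (p + 1) / 6) ∨
      (p % 12 = 7 ∧ N = (p - 1) / 6) ∨ (p % 12 = 11 ∧ N = (p + 7) / 6)) :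
    Module.Finite ℤ (HomZ ↥(subA R ⊓ subB L)) ∧
    Module.finrank ℤ (HomZ ↥(subA R ⊓ subB L)) = N := by
  have : Fact p.Prime := ⟨hp⟩
  have hmap : (MulAction.stabilizer SL2Z (PL.inf p)).map (iA R) = subA R ⊓ subB L := by
    ext x
    constructor
    · rintro ⟨g, hg, rfl⟩
      exact ⟨⟨g, rfl⟩, (iA_mem_B L g).2 ((mem_stab p g).1 hg)⟩
    · rintro ⟨⟨g, rfl⟩, hg⟩
      exact ⟨g, (mem_stab p g).2 ((iA_mem_B L g).1 hg), rfl⟩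
  let e := (Subgroup.equivMapOfInjective (MulAction.stabilizer SL2Z (PL.inf p)) (iA R)
    (iA_inj L)).trans (MulEquiv.subgroupCongr hmap)
  let e' := HomZ.congr e
  obtain ⟨h1, h2⟩ := finrank_HomZ (PL p) (PL.inf p) (PL_SS p)
  refine ⟨Module.Finite.equiv e', ?_⟩
  rw [← e'.finrank_eq]
  rw [nu2 p hp3, nu3 p hp3, card_PL] at h2
  split_ifs at h2 <;> omega

end H2SL2

namespace H2SL2
open Matrix ModularGroup

/-- The explicit character, as a function. -/
def psi {R : Type} [CommRing R] (a b c d : R) : R :=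
  (1 - c * c) * (b * d + 3 * (c - 1) * d + c + 3) + c * (a + d - 3)

theorem psi3T : ∀ a b c d : ZMod 3, a * d - b * c = 1 →
    psi a (a + b) c (c + d) = psi a b c d + 1 := by decide +kernel
theorem psi3S : ∀ a b c d : ZMod 3, a * d - b * c = 1 →
    psi b (-a) d (-c) = psi a b c d - 3 := by decide +kernel
theorem psi4T : ∀ a b c d : ZMod 4, a * d - b * c = 1 →
    psi a (a + b) c (c + d) = psi a b c d + 1 := by decide +kernel
theorem psi4S : ∀ a b c d : ZMod 4, a * d - b * c = 1 →
    psi b (-a) d (-c) = psi a b c d - 3 := by decide +kernel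

/-- The explicit character on matrices. -/
def psiM {R : Type} [CommRing R] (g : SL2 R) : R := psi (g 0 0) (g 0 1) (g 1 0) (g 1 1)

theorem psiM_one {R : Type} [CommRing R] : psiM (1 : SL2 R) = 0 := by
  simp [psiM, psi]

/-- Elements along which `psiM` is additive. -/
def psiGood (R : Type) [CommRing R] : Subgroup (SL2 R) where
  carrier := {g | ∀ h, psiM (h * g) = psiM h + psiM g}
  mul_mem' := by
    intro a b ha hb h
    rw [← mul_assoc, hb, ha, hb, add_assoc]
  one_mem' := by intro h; simp [psiM_one]
  inv_mem' := by
    intro a ha h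
    have h1 := ha (h * a⁻¹)
    have h2 := ha a⁻¹
    rw [inv_mul_cancel_right] at h1
    rw [inv_mul_cancel, psiM_one] at h2
    linear_combination -h1 + h2

theorem psiGood_T {R : Type} [CommRing R] (H : ∀ a b c d : R, a * d - b * c = 1 →
    psi a (a + b) c (c + d) = psi a b c d + 1) : mk2 1 1 0 1 (by ring) ∈ psiGood R := by
  intro h
  have := H _ _ _ _ (det_eq h)
  simp only [psiM, sl_mul, mk2_00, mk2_01, mk2_10, mk2_11, mul_one, mul_zero, add_zero]
  rw [this]
  simp [psi]

theorem psiGood_S {R : Type} [CommRing R] (H : ∀ a b c d : R, a * d - b * c = 1 →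
    psi b (-a) d (-c) = psi a b c d - 3) : mk2 0 (-1) 1 0 (by ring) ∈ psiGood R := by
  intro h
  have := H _ _ _ _ (det_eq h)
  simp only [psiM, sl_mul, mk2_00, mk2_01, mk2_10, mk2_11, mul_one, mul_zero, add_zero, zero_add,
    mul_neg]
  rw [this]
  simp [psi]
  ring

theorem S_eq : (S : SL2Z) = mk2 0 (-1) 1 0 (by norm_num) := by decide
theorem T_eq : (T : SL2Z) = mk2 1 1 0 1 (by norm_num) := by decide
theorem map_app {R K : Type} [CommRing R] [CommRing K] (f : R →+* K) (g : SL2 R) (i j : Fin 2) :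
    Matrix.SpecialLinearGroup.map f g i j = f (g i j) := rfl

theorem psi_char {p : ℕ} {R : Type} [CommRing R] (L : LocData p R) (hp : p.Prime) {K : Type}
    [CommRing K] (f : R →+* K) (hpK : (p : K) = 1 ∨ (p : K) = -1)
    (hT : ∀ a b c d : K, a * d - b * c = 1 → psi a (a + b) c (c + d) = psi a b c d + 1)
    (hS : ∀ a b c d : K, a * d - b * c = 1 → psi b (-a) d (-c) = psi a b c d - 3)
    (g h : SL2 R) :
    psiM (Matrix.SpecialLinearGroup.map f (g * h)) =
      psiM (Matrix.SpecialLinearGroup.map f g) + psiM (Matrix.SpecialLinearGroup.map f h) := by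
  have hT' := psiGood_T hT
  have hS' := psiGood_S hS
  have hq : f L.q = p := by
    have := congrArg f L.hq
    rw [map_mul, map_natCast, map_one] at this
    rcases hpK with e | e
    · rw [e] at this ⊢; linear_combination this
    · rw [e] at this ⊢; linear_combination -this
  have key : (psiGood K).comap (Matrix.SpecialLinearGroup.map f) = ⊤ := by
    rw [eq_top_iff, ← gen_top L hp, sup_le_iff]
    constructor
    · rintro _ ⟨x, rfl⟩
      have : x ∈ ((psiGood K).comap (Matrix.SpecialLinearGroup.map f)).comap (iA R) := by
        have : (⊤ : Subgroup SL2Z) ≤ ((psiGood K).comap (Matrix.SpecialLinearGroup.map f)).comap (iA R) := by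
          rw [← SpecialLinearGroup.SL2Z_generators, Subgroup.closure_le]
          rintro _ (rfl | rfl)
          · change Matrix.SpecialLinearGroup.map f (iA R S) ∈ psiGood K
            convert hS' using 1
            apply mk2_ext <;> simp [map_app, iA_apply, S_eq]
          · change Matrix.SpecialLinearGroup.map f (iA R T) ∈ psiGood K
            convert hT' using 1
            apply mk2_ext <;> simp [map_app, iA_apply, T_eq]
        exact this trivial
      exact this
    · rintro _ ⟨x, rfl⟩
      have : x ∈ ((psiGood K).comap (Matrix.SpecialLinearGroup.map f)).comap (iB L) := by
        have : (⊤ : Subgroup SL2Z) ≤ ((psiGood K).comap (Matrix.SpecialLinearGroup.map f)).comap (iB L) := by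
          rw [← SpecialLinearGroup.SL2Z_generators, Subgroup.closure_le]
          rcases hpK with e | e
          · rintro _ (rfl | rfl)
            · change Matrix.SpecialLinearGroup.map f (iB L S) ∈ psiGood K
              convert hS' using 1
              apply mk2_ext <;> simp [map_app, iB_apply, S_eq, hq, e]
            · change Matrix.SpecialLinearGroup.map f (iB L T) ∈ psiGood K
              convert hT' using 1
              apply mk2_ext <;> simp [map_app, iB_apply, T_eq, hq, e]
          · rintro _ (rfl | rfl)
            · change Matrix.SpecialLinearGroup.map f (iB L S) ∈ psiGood K
              convert (psiGood K).inv_mem hS' using 1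
              rw [eq_inv_iff_mul_eq_one]
              apply mk2_ext <;> simp [sl_mul, map_app, iB_apply, S_eq, hq, e]
            · change Matrix.SpecialLinearGroup.map f (iB L T) ∈ psiGood K
              convert (psiGood K).inv_mem hT' using 1
              rw [eq_inv_iff_mul_eq_one]
              apply mk2_ext <;> simp [sl_mul, map_app, iB_apply, T_eq, hq, e]
        exact this trivial
      exact this
  have hh : h ∈ (psiGood K).comap (Matrix.SpecialLinearGroup.map f) := by rw [key]; trivial
  rw [map_mul]
  exact hh _

/-- The unipotent generator. -/
def tau (R : Type) [CommRing R] : SL2 R := iA R T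

theorem tau_eq (R : Type) [CommRing R] : tau R = mk2 1 1 0 1 (by ring) := by
  apply mk2_ext <;> simp [tau, iA_apply, T_eq]

theorem exists_char {p : ℕ} {R : Type} [CommRing R] (L : LocData p R) (hp : p.Prime) (hp3 : 3 < p)
    (f3 : R →+* ZMod 3) (f4 : R →+* ZMod 4) :
    ∃ χ : SL2 R → ZMod 12, (∀ g h, χ (g * h) = χ g + χ h) ∧ χ (tau R) = 1 := by
  have hodd : p % 2 = 1 := hp.eq_two_or_odd.resolve_left (by omega)
  have h3 : p % 3 ≠ 0 := fun h => by
    have := (Nat.prime_dvd_prime_iff_eq Nat.prime_three hp).1 (Nat.dvd_of_mod_eq_zero h)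
    omega
  have c3 : (p : ZMod 3) = 1 ∨ (p : ZMod 3) = -1 := by
    rw [← ZMod.natCast_mod]
    have : p % 3 = 1 ∨ p % 3 = 2 := by omega
    rcases this with e | e <;> rw [e] <;> decide
  have c4 : (p : ZMod 4) = 1 ∨ (p : ZMod 4) = -1 := by
    rw [← ZMod.natCast_mod]
    have : p % 4 = 1 ∨ p % 4 = 3 := by omega
    rcases this with e | e <;> rw [e] <;> decide
  have m3 := psi_char L hp f3 c3 psi3T psi3S
  have m4 := psi_char L hp f4 c4 psi4T psi4S
  let k3 : ZMod 3 → ZMod 12 := fun x => 4 * (x.val : ZMod 12)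
  let k4 : ZMod 4 → ZMod 12 := fun x => -3 * (x.val : ZMod 12)
  have hk3 : ∀ x y, k3 (x + y) = k3 x + k3 y := by decide
  have hk4 : ∀ x y, k4 (x + y) = k4 x + k4 y := by decide
  refine ⟨fun g => k3 (psiM (Matrix.SpecialLinearGroup.map f3 g)) +
    k4 (psiM (Matrix.SpecialLinearGroup.map f4 g)), fun g h => ?_, ?_⟩
  · simp only [m3, m4, hk3, hk4]; ring
  · have e3 : psiM (Matrix.SpecialLinearGroup.map f3 (tau R)) = 1 := by
      simp [psiM, psi, tau_eq, map_app]
    have e4 : psiM (Matrix.SpecialLinearGroup.map f4 (tau R)) = 1 := by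
      simp [psiM, psi, tau_eq, map_app]
    simp only [e3, e4]
    decide

section
variable {p : ℕ} {R : Type} [CommRing R]

/-- An additive character as a homomorphism. -/
def charHom {G M : Type} [Group G] [AddCommGroup M] (χ : G → M) (hχ : ∀ g h, χ (g * h) = χ g + χ h) :
    G →* Multiplicative M := MonoidHom.mk' (fun g => Multiplicative.ofAdd (χ g)) (fun g h => by
      rw [hχ]; rfl)

theorem char_ext (L : LocData p R) (hp : p.Prime) {M : Type} [AddCommGroup M] (χ : SL2 R → M)
    (hχ : ∀ g h, χ (g * h) = χ g + χ h) (h1 : χ (iA R S) = 0) (h2 : χ (iA R T) = 0)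
    (h3 : χ (iB L S) = 0) (h4 : χ (iB L T) = 0) (g : SL2 R) : χ g = 0 := by
  have hA : (charHom χ hχ).comp (iA R) = 1 := by
    apply MonoidHom.eq_of_eqOn_dense SpecialLinearGroup.SL2Z_generators
    rintro _ (rfl | rfl)
    · exact h1
    · exact h2
  have hB : (charHom χ hχ).comp (iB L) = 1 := by
    apply MonoidHom.eq_of_eqOn_dense SpecialLinearGroup.SL2Z_generators
    rintro _ (rfl | rfl)
    · exact h3
    · exact h4
  have : (⊤ : Subgroup (SL2 R)) ≤ (charHom χ hχ).ker := by
    rw [← gen_top L hp, sup_le_iff]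
    constructor
    · rintro _ ⟨x, rfl⟩
      exact DFunLike.congr_fun hA x
    · rintro _ ⟨x, rfl⟩
      exact DFunLike.congr_fun hB x
  exact this (Subgroup.mem_top g)

theorem SL2Z_char_rel {M : Type} [AddCommGroup M] (χ : SL2Z → M)
    (hχ : ∀ g h, χ (g * h) = χ g + χ h) : χ S + 3 • χ T = 0 ∧ 4 • χ S = 0 := by
  have h1 : χ 1 = 0 := by
    have := hχ 1 1
    rw [mul_one] at this
    exact left_eq_add.1 this
  have e1 : (S : SL2Z) * S = S * T * (S * T) * (S * T) := by decide
  have e2 : (S : SL2Z) * S * (S * S) = 1 := by decide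
  have r1 := congrArg χ e1
  have r2 := congrArg χ e2
  simp only [hχ, h1] at r1 r2
  constructor
  · have := sub_eq_zero.2 r1.symm
    rw [← this]; abel
  · rw [← r2]; abel

theorem homZ_zero (L : LocData p R) (hp : p.Prime) (φ : SL2 R → ℤ)
    (hφ : ∀ g h, φ (g * h) = φ g + φ h) (g : SL2 R) : φ g = 0 := by
  have hA := SL2Z_char_rel (fun x => φ (iA R x)) (fun g h => by rw [map_mul, hφ])
  have hB := SL2Z_char_rel (fun x => φ (iB L x)) (fun g h => by rw [map_mul, hφ])
  simp at hA hB
  exact char_ext L hp φ hφ (by omega) (by omega) (by omega) (by omega) g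

theorem char_zero (L : LocData p R) (hp : p.Prime) (hp3 : 3 < p) (χ : SL2 R → ZMod 12)
    (hχ : ∀ g h, χ (g * h) = χ g + χ h) (h0 : χ (tau R) = 0) (g : SL2 R) : χ g = 0 := by
  have hA := SL2Z_char_rel (fun x => χ (iA R x)) (fun g h => by rw [map_mul, hχ])
  have hB := SL2Z_char_rel (fun x => χ (iB L x)) (fun g h => by rw [map_mul, hχ])
  have hpow : iB L T ^ p = tau R := by
    have e : (T : SL2Z) ^ p = mk2 1 (p : ℤ) 0 1 (by ring) :=
      Subtype.ext (by rw [← zpow_natCast]; exact coe_T_zpow p)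
    rw [← map_pow, e]
    apply mk2_ext <;> simp [iB_apply, tau_eq, L.hq]
  have h1 : χ 1 = 0 := by
    have := hχ 1 1
    rw [mul_one] at this
    exact left_eq_add.1 this
  have hpw : ∀ k : ℕ, χ (iB L T ^ k) = k * χ (iB L T) := by
    intro k
    induction k with
    | zero => simp [h1]
    | succ k ih => rw [pow_succ, hχ, ih]; push_cast; ring
  have hT : χ (iB L T) = 0 := by
    have e := hpw p
    rw [hpow, h0] at e
    have hu : IsUnit (p : ZMod 12) := by
      rw [ZMod.isUnit_iff_coprime]
      rw [Nat.Prime.coprime_iff_not_dvd hp]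
      intro h
      have : p ∣ 2 * 2 * 3 := h
      rw [hp.dvd_mul, hp.dvd_mul] at this
      rcases this with (h | h) | h <;> have := Nat.le_of_dvd (by norm_num) h <;> omega
    exact (hu.mul_right_eq_zero).1 e.symm
  have h0' : χ (iA R T) = 0 := h0
  simp only [hT, h0', smul_zero, add_zero] at hA hB
  exact char_ext L hp χ hχ hA.1 h0' hB.1 hT g

end
end H2SL2

namespace H2SL2
open Matrix ModularGroup

theorem assemble {Z M F : Type*} [AddCommGroup Z] [AddCommGroup M] [Module ℤ M] [AddCommGroup F]
    [Module.Finite ℤ F] [Module.Free ℤ F] (N : ℕ) (hN : Module.finrank ℤ F = N)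
    (π : Z →ₗ[ℤ] M) (hπ : Function.Surjective π) (R : Z →ₗ[ℤ] F)
    (hle : ∀ z, π z = 0 → R z = 0) (hR : ∀ h, ∃ f, R f = (12 : ℤ) • h)
    (ev : LinearMap.ker R →ₗ[ℤ] ZMod 12) (hev : Function.Surjective ev)
    (hev0 : ∀ x, ev x = 0 ↔ π x.1 = 0) :
    Nonempty (M ≃ₗ[ℤ] ((Fin N → ℤ) × ZMod 12)) := by
  have hfr : Module.finrank ℤ (LinearMap.range R) = N := by
    apply le_antisymm
    · rw [← hN]; exact Submodule.finrank_le _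
    · rw [← hN]
      let m : F →ₗ[ℤ] LinearMap.range R :=
        LinearMap.codRestrict _ ((12 : ℤ) • LinearMap.id) (fun h => hR h)
      refine LinearMap.finrank_le_finrank_of_injective (f := m) ?_
      intro x y h
      have h' : (12 : ℤ) • x = (12 : ℤ) • y := congrArg Subtype.val h
      exact smul_right_injective F (by norm_num) h'
  let e : LinearMap.range R ≃ₗ[ℤ] (Fin N → ℤ) :=
    (Module.finBasisOfFinrankEq ℤ (LinearMap.range R) hfr).equivFun
  obtain ⟨s, hs⟩ := Module.projective_lifting_property R.rangeRestrict LinearMap.id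
    R.surjective_rangeRestrict
  have hs' : ∀ y, R.rangeRestrict (s y) = y := fun y => DFunLike.congr_fun hs y
  have hs2 : ∀ y, R (s y) = y.1 := fun y => congrArg Subtype.val (hs' y)
  let pr : Z →ₗ[ℤ] LinearMap.ker R :=
    LinearMap.codRestrict _ (LinearMap.id - s.comp R.rangeRestrict) (fun z => by
      rw [LinearMap.mem_ker]
      simp [hs2])
  have hpr : ∀ z, (pr z).1 = z - s (R.rangeRestrict z) := fun z => rfl
  let Φ : Z →ₗ[ℤ] (Fin N → ℤ) × ZMod 12 := (e.toLinearMap.comp R.rangeRestrict).prod (ev.comp pr)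
  have hΦ : Function.Surjective Φ := by
    rintro ⟨v, n⟩
    obtain ⟨x, hx⟩ := hev n
    have hx0 : R.rangeRestrict x.1 = 0 := Subtype.ext (LinearMap.mem_ker.1 x.2)
    refine ⟨s (e.symm v) + x.1, ?_⟩
    have h1 : R.rangeRestrict (s (e.symm v) + x.1) = e.symm v := by
      rw [map_add, hs', hx0, add_zero]
    have h2 : pr (s (e.symm v) + x.1) = x := by
      apply Subtype.ext
      rw [hpr, h1]; abel
    change (e (R.rangeRestrict _), ev (pr _)) = _
    rw [h1, h2, hx]; simp
  have hker : LinearMap.ker π = LinearMap.ker Φ := by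
    ext z
    rw [LinearMap.mem_ker, LinearMap.mem_ker]
    change _ ↔ (e (R.rangeRestrict z), ev (pr z)) = (0, 0)
    rw [Prod.mk.injEq, LinearEquiv.map_eq_zero_iff, hev0, hpr]
    constructor
    · intro hz
      have : R.rangeRestrict z = 0 := Subtype.ext (hle z hz)
      refine ⟨this, ?_⟩
      rw [this, map_zero, sub_zero, hz]
    · rintro ⟨h1, h2⟩
      rwa [h1, map_zero, sub_zero] at h2
  exact ⟨((π.quotKerEquivOfSurjective hπ).symm.trans (Submodule.quotEquivOfEq _ _ hker)).trans
    (Φ.quotKerEquivOfSurjective hΦ)⟩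

theorem IsD_unique {p : ℕ} {R : Type} [CommRing R] (L : LocData p R) (hp : p.Prime)
    {f : SL2 R × SL2 R → ℤ} {φ φ' : SL2 R → ℤ} (h : IsD f φ) (h' : IsD f φ') : φ = φ' := by
  funext g
  have := homZ_zero L hp (fun g => φ g - φ' g) (fun g k => by
    have h1 := h g k
    have h2 := h' g k
    linarith) g
  linarith

theorem main_aux {p : ℕ} {R : Type} [CommRing R] (L : LocData p R) (hp : p.Prime) (hp3 : 3 < p)
    (f3 : R →+* ZMod 3) (f4 : R →+* ZMod 4) (N : ℕ)
    (hN : (p % 12 = 1 ∧ N = (p - 7) / 6) ∨ (p % 12 = 5 ∧ N = (p + 1) / 6) ∨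
      (p % 12 = 7 ∧ N = (p - 1) / 6) ∨ (p % 12 = 11 ∧ N = (p + 7) / 6))
    {M : Type*} [AddCommGroup M] [Module ℤ M] (π : Z2 (SL2 R) →ₗ[ℤ] M)
    (hπ : Function.Surjective π) (hπ0 : ∀ f, π f = 0 ↔ ∃ φ, IsD f.1 φ) :
    Nonempty (M ≃ₗ[ℤ] ((Fin N → ℤ) × ZMod 12)) := by
  obtain ⟨hfin, hrank⟩ := finrank_C L hp hp3 N hN
  obtain ⟨Rm, hR0, hR⟩ := exists_R (gen_top L hp) (isAmalgam_G L hp) (VProp_A L) (VProp_B L)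
  have hfree : Module.Free ℤ (HomZ ↥(subA R ⊓ subB L)) := inferInstance
  obtain ⟨χ, hχ, hχ1⟩ := exists_char L hp hp3 f3 f4
  have hex : ∀ f : LinearMap.ker Rm, ∃ φ, IsD ((12 : ℤ) • f.1).1 φ :=
    fun f => (hR0 f.1).1 (LinearMap.mem_ker.1 f.2)
  choose P hP using hex
  have hPd : ∀ (f : LinearMap.ker Rm) g h, 12 * f.1.1 (g, h) = P f h - P f (g * h) + P f g :=
    fun f g h => hP f g h
  let ev : LinearMap.ker Rm →ₗ[ℤ] ZMod 12 := AddMonoidHom.toIntLinearMap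
    (AddMonoidHom.mk' (fun f => (P f (tau R) : ZMod 12)) (fun f f' => by
      have : P (f + f') = fun g => P f g + P f' g := by
        refine IsD_unique L hp (hP (f + f')) ?_
        intro g h
        have h1 := hPd f g h
        have h2 := hPd f' g h
        change 12 * (f.1.1 (g, h) + f'.1.1 (g, h)) = _
        linarith
      rw [this]; push_cast; rfl))
  have hle : ∀ z, π z = 0 → Rm z = 0 := by
    intro z hz
    obtain ⟨φ, hφ⟩ := (hπ0 z).1 hz
    refine (hR0 z).2 ⟨fun g => 12 * φ g, fun g h => ?_⟩
    have := hφ g h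
    change 12 * z.1 (g, h) = _
    rw [this]; ring
  refine assemble N hrank π hπ Rm hle hR ev ?_ ?_
  · intro n
    let ψ : SL2 R → ℤ := fun g => ((n * χ g).val : ℤ)
    have hψ : ∀ g, (ψ g : ZMod 12) = n * χ g := by
      intro g
      change (((n * χ g).val : ℤ) : ZMod 12) = _
      rw [Int.cast_natCast, ZMod.natCast_zmod_val]
    have hdvd : ∀ g h, (12 : ℤ) ∣ ψ h - ψ (g * h) + ψ g := by
      intro g h
      have := (ZMod.intCast_zmod_eq_zero_iff_dvd (ψ h - ψ (g * h) + ψ g) 12).1 (by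
        push_cast
        rw [hψ, hψ, hψ, hχ]; ring)
      exact_mod_cast this
    choose F hF using hdvd
    let f : Z2 (SL2 R) := ⟨fun x => F x.1 x.2, by
      intro g h j
      have h1 := hF (g * h) j
      have h2 := hF g h
      have h3 := hF h j
      have h4 := hF g (h * j)
      rw [mul_assoc] at h1
      change F (g * h) j + F g h = F h j + F g (h * j)
      linarith⟩
    have hfψ : IsD ((12 : ℤ) • f).1 ψ := fun g h => (hF g h).symm
    have hfk : f ∈ LinearMap.ker Rm := (hR0 f).2 ⟨ψ, hfψ⟩
    refine ⟨⟨f, hfk⟩, ?_⟩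
    change (P ⟨f, hfk⟩ (tau R) : ZMod 12) = n
    rw [IsD_unique L hp (hP ⟨f, hfk⟩) hfψ, hψ, hχ1, mul_one]
  · intro x
    change (P x (tau R) : ZMod 12) = 0 ↔ _
    rw [hπ0]
    constructor
    · intro h0
      have hz := char_zero L hp hp3 (fun g => (P x g : ZMod 12)) (fun g h => by
        have := congrArg (Int.cast : ℤ → ZMod 12) (hPd x g h)
        push_cast at this
        rw [show (12 : ZMod 12) = 0 from rfl, zero_mul] at this
        linear_combination this) h0
      have hd : ∀ g, (12 : ℤ) ∣ P x g := fun g => by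
        have := (ZMod.intCast_zmod_eq_zero_iff_dvd (P x g) 12).1 (hz g)
        exact_mod_cast this
      choose φ hφ using hd
      refine ⟨φ, fun g h => ?_⟩
      have := hPd x g h
      rw [hφ, hφ, hφ] at this
      linarith
    · rintro ⟨φ, hφ⟩
      have : P x = fun g => 12 * φ g := IsD_unique L hp (hP x) (fun g h => by
        have := hφ g h
        change 12 * x.1.1 (g, h) = _
        rw [this]; ring)
      rw [this]
      push_cast
      rw [show (12 : ZMod 12) = 0 from rfl, zero_mul]

open groupCohomology in
/-- Our cocycles as Mathlib cocycles. -/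
noncomputable def toCoc (G : Type) [Group G] :
    Z2 G →ₗ[ℤ] cocycles₂ (Rep.trivial ℤ G ℤ) where
  toFun := fun f => ⟨f.1, (mem_cocycles₂_iff (A := Rep.trivial ℤ G ℤ) f.1).2 f.2⟩
  map_add' := fun _ _ => rfl
  map_smul' := fun _ _ => rfl

open groupCohomology in
/-- From cocycles to cohomology. -/
noncomputable def toH2 (G : Type) [Group G] :
    Z2 G →ₗ[ℤ] groupCohomology (Rep.trivial ℤ G ℤ) 2 :=
  (H2π (Rep.trivial ℤ G ℤ)).hom.comp (toCoc G)

open groupCohomology in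
theorem toH2_surjective (G : Type) [Group G] : Function.Surjective (toH2 G) := by
  intro x
  induction x using H2_induction_on with
  | h f => exact ⟨⟨f.1, (mem_cocycles₂_iff (A := Rep.trivial ℤ G ℤ) f.1).1 f.2⟩, rfl⟩

open groupCohomology in
theorem toH2_eq_zero (G : Type) [Group G] (f : Z2 G) : toH2 G f = 0 ↔ ∃ φ, IsD f.1 φ := by
  refine (H2π_eq_zero_iff (A := Rep.trivial ℤ G ℤ)
    ⟨f.1, (mem_cocycles₂_iff (A := Rep.trivial ℤ G ℤ) f.1).2 f.2⟩).trans ?_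
  constructor
  · rintro ⟨φ, hφ⟩
    exact ⟨φ, fun g h => (congrFun hφ (g, h)).symm⟩
  · rintro ⟨φ, hφ⟩
    exact ⟨φ, funext fun x => (hφ x.1 x.2).symm⟩

theorem locHom (p : ℕ) (n : ℕ) (h : IsUnit (p : ZMod n)) :
    Nonempty (Localization.Away (p : ℤ) →+* ZMod n) :=
  ⟨IsLocalization.Away.lift (S := Localization.Away (p : ℤ)) (g := Int.castRingHom (ZMod n)) (p : ℤ)
    (by simpa using h)⟩

end H2SL2


/-- For a prime `p > 3`, `H²(SL₂(ℤ[1/p]), ℤ) ≅ ℤ^{N(p)} ⊕ ℤ/12`, where `N(p)` depends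
on `p mod 12` as in Adem–Naffah. -/
theorem H2_SL2_Z_inv_p (p : ℕ) (hp : p.Prime) (hp3 : 3 < p) (N : ℕ)
    (hN : (p % 12 = 1 ∧ N = (p - 7) / 6) ∨ (p % 12 = 5 ∧ N = (p + 1) / 6) ∨
      (p % 12 = 7 ∧ N = (p - 1) / 6) ∨ (p % 12 = 11 ∧ N = (p + 7) / 6)) :
    Nonempty ((groupCohomology (Rep.trivial ℤ
      (Matrix.SpecialLinearGroup (Fin 2) (Localization.Away (p : ℤ))) ℤ) 2) ≃ₗ[ℤ]
        ((Fin N → ℤ) × ZMod 12)) := by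
  have h3 : IsUnit (p : ZMod 3) := by
    rw [ZMod.isUnit_iff_coprime, hp.coprime_iff_not_dvd]
    intro h
    have := Nat.le_of_dvd (by norm_num) h
    omega
  have h4 : IsUnit (p : ZMod 4) := by
    rw [ZMod.isUnit_iff_coprime, hp.coprime_iff_not_dvd]
    intro h
    have h' : p ∣ 2 * 2 := h
    rw [hp.dvd_mul, or_self] at h'
    have := Nat.le_of_dvd (by norm_num) h'
    omega
  obtain ⟨f3⟩ := H2SL2.locHom p 3 h3
  obtain ⟨f4⟩ := H2SL2.locHom p 4 h4
  exact H2SL2.main_aux (H2SL2.locData p hp) hp hp3 f3 f4 N hN (H2SL2.toH2 _)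
    (H2SL2.toH2_surjective _) (H2SL2.toH2_eq_zero _)
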